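/- For every fixed rational point s ∈ V_ℚ, the map c ↦ μ(s + c) is a valuation on the set of rational convex cones in V: if c_i is a finite family of rational cones in V whose characteristic functions satisfy a linear relation Σ_i r_i χ(c_i) = 0, then Σ_i r_i μ(s + c_i) = 0. -/

import Mathlib

open MeasureTheory Filter Topology Set
open scoped RealInnerProductSpace Pointwise BigOperators

noncomputable section

/-- the ambient rational vector space: `ℝ^d` with the standard inner product, which is used
to identify `V` with its dual space `V^*`. -/
abbrev Vd (d : ℕ) := EuclideanSpace ℝ (Fin d)

variable {d : ℕ}

/-- the duality pairing `⟨ξ, x⟩` between `V^*` and `V`, realized by the standard inner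
product of `ℝ^d`. -/
def pairE {d : ℕ} (ξ x : Vd d) : ℝ := @inner ℝ _ _ ξ x

/-- `Λ` is a lattice of its span: it is generated by finitely many `ℝ`-independent vectors. -/
def IsLatticeSub (Λ : AddSubgroup (Vd d)) : Prop :=
  ∃ (k : ℕ) (v : Fin k → Vd d), LinearIndependent ℝ v ∧
    Λ = AddSubgroup.closure (Set.range v)

/-- `Λ` is a full-rank lattice in `ℝ^d`. -/
def IsFullLattice (Λ : AddSubgroup (Vd d)) : Prop :=
  IsLatticeSub Λ ∧ Submodule.span ℝ (Λ : Set (Vd d)) = ⊤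

/-- `x` is a rational point with respect to the lattice `Λ`. -/
def IsRatPoint (Λ : AddSubgroup (Vd d)) (x : Vd d) : Prop :=
  ∃ q : ℤ, q ≠ 0 ∧ (q : ℝ) • x ∈ Λ

/-- viewing `φ ∈ V` as a linear functional via the standard pairing, it takes integer values
on `Λ`, i.e. it belongs to the dual lattice. -/
def IsDualIntegral (Λ : AddSubgroup (Vd d)) (φ : Vd d) : Prop :=
  ∀ x ∈ Λ, ∃ n : ℤ, (pairE (φ) (x)) = (n : ℝ)

/-- a rational polyhedron (inside the span of `Λ`): a finite intersection of half-spaces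
bounded by rational affine hyperplanes. -/
def IsRatPolyhedron (Λ : AddSubgroup (Vd d)) (P : Set (Vd d)) : Prop :=
  ∃ (n : ℕ) (φ : Fin n → Vd d) (c : Fin n → ℚ),
    (∀ i, IsDualIntegral Λ (φ i)) ∧
    P = {x | x ∈ Submodule.span ℝ (Λ : Set (Vd d)) ∧ ∀ i, (pairE (φ i) x) ≤ (c i : ℝ)}

/-- the set `P` contains a straight (affine) line. -/
def ContainsLine (P : Set (Vd d)) : Prop :=
  ∃ x u : Vd d, u ≠ 0 ∧ ∀ t : ℝ, x + t • u ∈ P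

/-- equality of meromorphic-type functions near `0`: they agree near `0` outside a closed
set with empty interior (the polar set). -/
def MeroEqAt0 (f g : Vd d → ℝ) : Prop :=
  ∃ Z : Set (Vd d), IsClosed Z ∧ interior Z = ∅ ∧
    ∀ᶠ ξ in 𝓝 (0 : Vd d), ξ ∉ Z → f ξ = g ξ

/-- `g` is analytic at `0` and its Taylor coefficients are rational with respect to an
integral basis (i.e. the coefficients take rational values on dual-lattice vectors). -/
def HasRatSeriesAt0 (Λ : AddSubgroup (Vd d)) (g : Vd d → ℝ) : Prop :=
  ∃ p : FormalMultilinearSeries ℝ (Vd d) ℝ, HasFPowerSeriesAt g p 0 ∧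
    ∀ (n : ℕ) (w : Fin n → Vd d), (∀ i, IsDualIntegral Λ (w i)) →
      ∃ q : ℚ, (p n) w = (q : ℝ)

/-- `f` is meromorphic near `0` with rational Taylor coefficients: near `0` it is a quotient
of two analytic functions with rational Taylor coefficients. -/
def RatMeromorphicAt0 (Λ : AddSubgroup (Vd d)) (f : Vd d → ℝ) : Prop :=
  ∃ g h : Vd d → ℝ, HasRatSeriesAt0 Λ g ∧ HasRatSeriesAt0 Λ h ∧
    (¬ ∀ᶠ ξ in 𝓝 (0 : Vd d), h ξ = 0) ∧
    (∀ᶠ ξ in 𝓝 (0 : Vd d), h ξ ≠ 0 → f ξ * h ξ = g ξ)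

/-- `m` is the canonical Lebesgue measure carried by the rational affine subspace `A`,
normalized so that a fundamental parallelepiped of the lattice `Λ ∩ lin(A)` has volume `1`:
it is the image of the standard Lebesgue measure under a `ℤ`-basis parametrization. -/
def IsCanonicalMeasure (Λ : AddSubgroup (Vd d)) (A : Set (Vd d)) (m : Measure (Vd d)) : Prop :=
  ∃ (k : ℕ) (x₀ : Vd d) (v : Fin k → Vd d),
    x₀ ∈ A ∧ (∀ i, v i ∈ Λ) ∧ LinearIndependent ℝ v ∧
    A = {x | ∃ t : Fin k → ℝ, x = x₀ + ∑ i, t i • v i} ∧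
    (∀ y ∈ Λ, y ∈ Submodule.span ℝ (Set.range v) →
      ∃ c : Fin k → ℤ, y = ∑ i, (c i : ℝ) • v i) ∧
    m = Measure.map (fun t : Fin k → ℝ => x₀ + ∑ i, t i • v i) volume

/-- the characterizing properties of the map `I`: it sends rational polyhedra to meromorphic
functions with rational coefficients, vanishes on polyhedra containing lines, and is given by
`∫_P e^{⟨ξ,x⟩} dm_{<P>}(x)` wherever this integral converges. -/
def IsIMap (Λ : AddSubgroup (Vd d)) (I : Set (Vd d) → Vd d → ℝ) : Prop :=
  (∀ P, IsRatPolyhedron Λ P → RatMeromorphicAt0 Λ (I P)) ∧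
  (∀ P, IsRatPolyhedron Λ P → ContainsLine P → ∀ ξ, I P ξ = 0) ∧
  (∀ P, IsRatPolyhedron Λ P → ∀ m : Measure (Vd d),
    IsCanonicalMeasure Λ ((affineSpan ℝ P : AffineSubspace ℝ (Vd d)) : Set (Vd d)) m →
    ∀ ξ : Vd d, IntegrableOn (fun x => Real.exp (pairE (ξ) (x))) P m →
      I P ξ = ∫ x in P, Real.exp (pairE (ξ) (x)) ∂m)

/-- the characterizing properties of the map `S`: it sends rational polyhedra to meromorphic
functions with rational coefficients, vanishes on polyhedra containing lines, and is given by
`∑_{x ∈ P ∩ Λ} e^{⟨ξ,x⟩}` wherever this sum converges absolutely. -/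
def IsSMap (Λ : AddSubgroup (Vd d)) (S : Set (Vd d) → Vd d → ℝ) : Prop :=
  (∀ P, IsRatPolyhedron Λ P → RatMeromorphicAt0 Λ (S P)) ∧
  (∀ P, IsRatPolyhedron Λ P → ContainsLine P → ∀ ξ, S P ξ = 0) ∧
  (∀ P, IsRatPolyhedron Λ P → ∀ ξ : Vd d,
    Summable (fun x : ↥(P ∩ (Λ : Set (Vd d))) => Real.exp (pairE ξ (x : Vd d))) →
      S P ξ = ∑' x : ↥(P ∩ (Λ : Set (Vd d))), Real.exp (pairE ξ (x : Vd d)))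

/-- `F` is a (nonempty, exposed) face of the convex set `P`. -/
def IsFaceOf (P F : Set (Vd d)) : Prop :=
  F.Nonempty ∧ ∃ φ : Vd d, F = {x ∈ P | ∀ y ∈ P, (pairE (φ) (y)) ≤ (pairE (φ) (x))}

/-- `v` is a vertex of `P`. -/
def IsVertexOf (P : Set (Vd d)) (v : Vd d) : Prop := IsFaceOf P {v}

/-- the cone of feasible directions of `P` along the face `F` (computed at a point of the
relative interior of `F`). -/
def feasibleCone (P F : Set (Vd d)) : Set (Vd d) :=
  {u | ∃ x ∈ intrinsicInterior ℝ F, ∃ ε : ℝ, 0 < ε ∧ ∀ t : ℝ, 0 < t → t ≤ ε → x + t • u ∈ P}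

/-- the supporting cone `<F> + c(P,F)` of `P` along its face `F`. -/
def suppCone (P F : Set (Vd d)) : Set (Vd d) :=
  {z | ∃ a ∈ (affineSpan ℝ F : Set (Vd d)), ∃ u ∈ feasibleCone P F, z = a + u}

/-- the recession cone (cone of directions) of a convex set. -/
def recCone (P : Set (Vd d)) : Set (Vd d) :=
  {u | ∀ x ∈ P, ∀ t : ℝ, 0 ≤ t → x + t • u ∈ P}

/-- a rational affine cone with respect to the lattice `Λ`: a rational translate of a cone
generated by finitely many lattice vectors. -/
def IsRatAffineCone (Λ : AddSubgroup (Vd d)) (a : Set (Vd d)) : Prop :=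
  ∃ (s : Vd d) (n : ℕ) (v : Fin n → Vd d), IsRatPoint Λ s ∧ (∀ i, v i ∈ Λ) ∧
    a = {x | ∃ t : Fin n → ℝ, (∀ i, 0 ≤ t i) ∧ x = s + ∑ i, t i • v i}

/-- a rational (convex polyhedral) cone with vertex at the origin. -/
def IsRatCone (Λ : AddSubgroup (Vd d)) (c : Set (Vd d)) : Prop :=
  ∃ (n : ℕ) (v : Fin n → Vd d), (∀ i, v i ∈ Λ) ∧
    c = {x | ∃ t : Fin n → ℝ, (∀ i, 0 ≤ t i) ∧ x = ∑ i, t i • v i}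

/-- `Q` is a rational scalar product: a symmetric positive definite bilinear form taking
rational values on lattice vectors. -/
def IsRatInner (Λ : AddSubgroup (Vd d)) (Q : Vd d →ₗ[ℝ] Vd d →ₗ[ℝ] ℝ) : Prop :=
  (∀ x y, Q x y = Q y x) ∧ (∀ x : Vd d, x ≠ 0 → 0 < Q x x) ∧
  (∀ x ∈ Λ, ∀ y ∈ Λ, ∃ q : ℚ, Q x y = (q : ℝ))

/-- `π` realizes the quotient map `V → V/L` as the `Q`-orthogonal projection onto the
`Q`-orthogonal complement of `L`. -/
def IsQCoproj (Q : Vd d →ₗ[ℝ] Vd d →ₗ[ℝ] ℝ) (L : Submodule ℝ (Vd d))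
    (π : Vd d →ₗ[ℝ] Vd d) : Prop :=
  (∀ x, x - π x ∈ L) ∧ (∀ x : Vd d, ∀ y ∈ L, Q (π x) y = 0)

/-- `Λ'` is the lattice of a rational quotient space of `(V, Λ)`, realized inside `V` via the
`Q`-orthogonal projection along a rational subspace. -/
def IsQuotLattice (Q : Vd d →ₗ[ℝ] Vd d →ₗ[ℝ] ℝ) (Λ Λ' : AddSubgroup (Vd d)) : Prop :=
  ∃ (L : Submodule ℝ (Vd d)) (π : Vd d →ₗ[ℝ] Vd d),
    Submodule.span ℝ ((L : Set (Vd d)) ∩ (Λ : Set (Vd d))) = L ∧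
    IsQCoproj Q L π ∧ Λ' = AddSubgroup.map π.toAddMonoidHom Λ

/-- a family of maps `I` indexed by the rational quotient spaces of `(V,Λ)`, each member
satisfying the characterizing properties of the integral generating function. -/
def IsIFamily (Q : Vd d →ₗ[ℝ] Vd d →ₗ[ℝ] ℝ) (Λ : AddSubgroup (Vd d))
    (I : AddSubgroup (Vd d) → Set (Vd d) → Vd d → ℝ) : Prop :=
  ∀ Λ', IsQuotLattice Q Λ Λ' → IsIMap Λ' (I Λ')

/-- a family of maps `S` indexed by the rational quotient spaces of `(V,Λ)`, each member
satisfying the characterizing properties of the lattice-point generating function. -/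
def IsSFamily (Q : Vd d →ₗ[ℝ] Vd d →ₗ[ℝ] ℝ) (Λ : AddSubgroup (Vd d))
    (S : AddSubgroup (Vd d) → Set (Vd d) → Vd d → ℝ) : Prop :=
  ∀ Λ', IsQuotLattice Q Λ Λ' → IsSMap Λ' (S Λ')

/-- the defining properties (a),(b),(c) of the family `μ` of Berline--Vergne:
each `μ(a)` is meromorphic with rational coefficients near `0`, `μ_{0}({0}) = 1`, and for
every pointed rational affine cone `a` in a rational quotient `W` of `V` one has
`S(a) = ∑_{f ∈ F(a)} μ(t(a,f)) I(f)`, where the transverse cone `t(a,f)` is realized inside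
`V` by the `Q`-orthogonal projection `π F` along `lin(f)`, and functions on quotient duals
are extended by `Q`-orthogonal projection. -/
def IsMuCore (Λ : AddSubgroup (Vd d)) (Q : Vd d →ₗ[ℝ] Vd d →ₗ[ℝ] ℝ)
    (I S μ : AddSubgroup (Vd d) → Set (Vd d) → Vd d → ℝ) : Prop :=
  (∀ Λ', IsQuotLattice Q Λ Λ' → ∀ a, IsRatAffineCone Λ' a → ¬ ContainsLine a →
      RatMeromorphicAt0 Λ' (μ Λ' a)) ∧
  (∀ ξ, μ ⊥ ({0} : Set (Vd d)) ξ = 1) ∧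
  (∀ Λ', IsQuotLattice Q Λ Λ' → ∀ a, IsRatAffineCone Λ' a → ¬ ContainsLine a →
    ∀ π : Set (Vd d) → (Vd d →ₗ[ℝ] Vd d),
      (∀ F, IsFaceOf a F → IsQCoproj Q (affineSpan ℝ F).direction (π F)) →
      MeroEqAt0 (S Λ' a)
        (fun ξ => ∑ᶠ F ∈ {F | IsFaceOf a F},
          μ (AddSubgroup.map (π F).toAddMonoidHom Λ') ((π F) '' suppCone a F) ξ
            * I Λ' F ξ))

/-- the family `μ`, extended by `μ(a) = 0` on cones containing a straight line. -/
def IsMuFamily (Λ : AddSubgroup (Vd d)) (Q : Vd d →ₗ[ℝ] Vd d →ₗ[ℝ] ℝ)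
    (I S μ : AddSubgroup (Vd d) → Set (Vd d) → Vd d → ℝ) : Prop :=
  IsMuCore Λ Q I S μ ∧
  (∀ Λ', IsQuotLattice Q Λ Λ' → ∀ a, IsRatAffineCone Λ' a → ContainsLine a →
    ∀ ξ, μ Λ' a ξ = 0)

/-- the trace pairing of two `n`-multilinear forms on `ℝ^d`, computed in the standard basis. -/
def multiPair {n : ℕ} (p q : ContinuousMultilinearMap ℝ (fun _ : Fin n => Vd d) ℝ) : ℝ :=
  ∑ ι : Fin n → Fin d,
    p (fun j => (EuclideanSpace.basisFun (Fin d) ℝ) (ι j)) *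
    q (fun j => (EuclideanSpace.basisFun (Fin d) ℝ) (ι j))

/-- the action on `h` of the infinite-order constant-coefficient differential operator whose
symbol has Taylor series `p` at `0`; on polynomials `h` the sum is finite.  Its defining
property is `D(Φ)e^{⟨ξ,·⟩} = Φ(ξ)e^{⟨ξ,·⟩}`. -/
def DOp (p : FormalMultilinearSeries ℝ (Vd d) ℝ) (h : Vd d → ℝ) (x : Vd d) : ℝ :=
  ∑ᶠ n : ℕ, multiPair (p n) (iteratedFDeriv ℝ n h x)

/-- `h` is a polynomial function on `ℝ^d`. -/
def IsPolyFun (h : Vd d → ℝ) : Prop :=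
  ∃ p : MvPolynomial (Fin d) ℝ, ∀ x : Vd d, h x = MvPolynomial.eval (fun i => x i) p

/-- `h` is a polynomial function of degree at most `r` on `ℝ^d`. -/
def IsPolyFunOfDeg (h : Vd d → ℝ) (r : ℕ) : Prop :=
  ∃ p : MvPolynomial (Fin d) ℝ, p.totalDegree ≤ r ∧
    ∀ x : Vd d, h x = MvPolynomial.eval (fun i => x i) p

end

open MeasureTheory Filter Topology Set
open scoped RealInnerProductSpace Pointwise BigOperators

/-! ### Generic properties near `0` -/

/-- `p` holds near `0` outside a closed set with empty interior. -/
def Gen {d : ℕ} (p : Vd d → Prop) : Prop :=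
  ∃ Z : Set (Vd d), IsClosed Z ∧ interior Z = ∅ ∧ ∀ᶠ ξ in 𝓝 (0 : Vd d), ξ ∉ Z → p ξ

theorem Gen.mono {d : ℕ} {p q : Vd d → Prop} (h : Gen p) (hpq : ∀ ξ, p ξ → q ξ) : Gen q := by
  obtain ⟨Z, h1, h2, h3⟩ := h
  exact ⟨Z, h1, h2, h3.mono fun ξ hξ hZ => hpq ξ (hξ hZ)⟩

theorem Gen.of_forall {d : ℕ} {p : Vd d → Prop} (h : ∀ ξ, p ξ) : Gen p :=
  ⟨∅, isClosed_empty, interior_empty, Eventually.of_forall fun ξ _ => h ξ⟩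

theorem Gen.and {d : ℕ} {p q : Vd d → Prop} (hp : Gen p) (hq : Gen q) :
    Gen fun ξ => p ξ ∧ q ξ := by
  obtain ⟨Z, h1, h2, h3⟩ := hp
  obtain ⟨Z', h1', h2', h3'⟩ := hq
  refine ⟨Z ∪ Z', h1.union h1', ?_, ?_⟩
  · rw [interior_union_isClosed_of_interior_empty h1 h2', h2]
  · filter_upwards [h3, h3'] with ξ a b hZ
    exact ⟨a fun h => hZ (Or.inl h), b fun h => hZ (Or.inr h)⟩

theorem Gen.finset {d : ℕ} {ι : Type*} (s : Finset ι) {p : ι → Vd d → Prop}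
    (h : ∀ i ∈ s, Gen (p i)) : Gen fun ξ => ∀ i ∈ s, p i ξ := by
  classical
  induction s using Finset.induction_on with
  | empty => exact Gen.of_forall (by simp)
  | insert a s ha ih =>
    refine ((h a (by simp)).and (ih fun i hi => h i (by simp [hi]))).mono ?_
    intro ξ hξ i hi
    rcases Finset.mem_insert.1 hi with rfl | hi
    · exact hξ.1
    · exact hξ.2 i hi

theorem Gen.all {d : ℕ} {ι : Type*} [Fintype ι] {p : ι → Vd d → Prop}
    (h : ∀ i, Gen (p i)) : Gen fun ξ => ∀ i, p i ξ :=
  (Gen.finset Finset.univ fun i _ => h i).mono fun ξ hξ i => hξ i (Finset.mem_univ i)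

/-- an analytic function near `0` that is not identically zero is generically non zero -/
theorem Gen.analytic_ne {d : ℕ} {h : Vd d → ℝ} (ha : AnalyticAt ℝ h 0)
    (hne : ¬ ∀ᶠ ξ in 𝓝 (0 : Vd d), h ξ = 0) : Gen fun ξ => h ξ ≠ 0 := by
  obtain ⟨r, hr, hball⟩ := Metric.eventually_nhds_iff_ball.1 ha.eventually_analyticAt
  have hsub : Metric.closedBall (0 : Vd d) (r / 2) ⊆ Metric.ball 0 r :=
    Metric.closedBall_subset_ball (by linarith)
  refine ⟨Metric.closedBall 0 (r/2) ∩ h ⁻¹' {0}, ?_, ?_, ?_⟩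
  · refine ContinuousOn.preimage_isClosed_of_isClosed ?_ Metric.isClosed_closedBall
      isClosed_singleton
    exact fun x hx => (hball x (hsub hx)).continuousAt.continuousWithinAt
  · by_contra hcon
    obtain ⟨z, hz⟩ := Set.nonempty_iff_ne_empty.2 hcon
    have hz2 := mem_interior_iff_mem_nhds.1 hz
    have hzz := interior_subset hz
    have hA : AnalyticOnNhd ℝ h (Metric.ball 0 r) := fun x hx => hball x hx
    have := hA.eqOn_zero_of_preconnected_of_eventuallyEq_zero
      (convex_ball (0 : Vd d) r).isPreconnected (hsub hzz.1)
      (by filter_upwards [hz2] with y hy using hy.2)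
    apply hne
    filter_upwards [Metric.ball_mem_nhds (0 : Vd d) hr] with y hy using this hy
  · filter_upwards [Metric.closedBall_mem_nhds (0 : Vd d) (by linarith : 0 < r/2)] with ξ hξ hZ h0
    exact hZ ⟨hξ, h0⟩

theorem pairE_add_right {d : ℕ} (ξ x y : Vd d) : pairE ξ (x + y) = pairE ξ x + pairE ξ y :=
  inner_add_right _ _ _
theorem pairE_sub_right {d : ℕ} (ξ x y : Vd d) : pairE ξ (x - y) = pairE ξ x - pairE ξ y :=
  inner_sub_right _ _ _
theorem pairE_smul_right {d : ℕ} (ξ x : Vd d) (t : ℝ) : pairE ξ (t • x) = t * pairE ξ x :=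
  inner_smul_right _ _ _
theorem pairE_sum_right {d : ℕ} {ι : Type*} (s : Finset ι) (ξ : Vd d) (f : ι → Vd d) :
    pairE ξ (∑ i ∈ s, f i) = ∑ i ∈ s, pairE ξ (f i) := inner_sum _ _ _
theorem pairE_add_left {d : ℕ} (ξ η x : Vd d) : pairE (ξ + η) x = pairE ξ x + pairE η x :=
  inner_add_left _ _ _
theorem pairE_smul_left {d : ℕ} (ξ x : Vd d) (t : ℝ) : pairE (t • ξ) x = t * pairE ξ x := by
  simp [pairE, inner_smul_left]
theorem pairE_neg_left {d : ℕ} (ξ x : Vd d) : pairE (-ξ) x = - pairE ξ x := by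
  simp [pairE]
theorem pairE_zero_right {d : ℕ} (ξ : Vd d) : pairE ξ 0 = 0 := inner_zero_right _
theorem pairE_zero_left {d : ℕ} (ξ : Vd d) : pairE 0 ξ = 0 := inner_zero_left _
theorem continuous_pairE {d : ℕ} (ξ : Vd d) : Continuous (fun x => pairE ξ x) := by
  unfold pairE; fun_prop
theorem continuous_pairE_left {d : ℕ} (x : Vd d) : Continuous (fun ξ => pairE ξ x) := by
  unfold pairE; fun_prop

theorem Gen.pair_ne {d : ℕ} {v : Vd d} (hv : v ≠ 0) : Gen fun ξ => pairE ξ v ≠ 0 := by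
  apply Gen.analytic_ne
  · have : (fun ξ => pairE ξ v) = fun ξ => (innerSL ℝ v) ξ := by
      ext ξ; simp [pairE, real_inner_comm]
    rw [this]; exact (innerSL ℝ v).analyticAt 0
  · intro h
    have ht : Tendsto (fun t : ℝ => t • v) (𝓝[>] 0) (𝓝 0) := by
      have : Tendsto (fun t : ℝ => t • v) (𝓝 0) (𝓝 ((0:ℝ) • v)) :=
        (continuous_id.smul continuous_const).tendsto 0
      rw [zero_smul] at this
      exact this.mono_left nhdsWithin_le_nhds
    obtain ⟨t, h1, h2⟩ := ((ht.eventually h).and self_mem_nhdsWithin).exists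
    rw [pairE_smul_left] at h1
    have : pairE v v ≠ 0 := by simpa [pairE] using hv
    rcases mul_eq_zero.1 h1 with h | h
    · exact (ne_of_gt h2) h
    · exact this h

/-! ### Difference operators -/

/-- iterated difference operator -/
def DD {d : ℕ} : List (Vd d) → (Vd d → ℝ) → Vd d → ℝ
  | [], F => F
  | v :: l, F => fun x => DD l F x - DD l F (x - v)

theorem DD_append {d : ℕ} (l₁ l₂ : List (Vd d)) (F : Vd d → ℝ) :
    DD (l₁ ++ l₂) F = DD l₁ (DD l₂ F) := by
  induction l₁ with
  | nil => rfl
  | cons v l ih => simp [DD, ih]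

theorem DD_perm {d : ℕ} {l₁ l₂ : List (Vd d)} (h : l₁.Perm l₂) (F : Vd d → ℝ) :
    DD l₁ F = DD l₂ F := by
  induction h with
  | nil => rfl
  | cons x _ ih => simp [DD, ih]
  | swap x y l =>
    ext z; simp only [DD]
    rw [sub_right_comm z x y]; ring
  | trans _ _ h1 h2 => exact h1.trans h2

theorem DD_zero {d : ℕ} (l : List (Vd d)) : DD l (fun _ => 0) = fun _ => 0 := by
  induction l with
  | nil => rfl
  | cons v l ih => simp [DD, ih]

theorem DD_add {d : ℕ} (l : List (Vd d)) (F G : Vd d → ℝ) :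
    DD l (fun x => F x + G x) = fun x => DD l F x + DD l G x := by
  induction l with
  | nil => rfl
  | cons v l ih => ext x; simp only [DD, ih]; ring

theorem DD_smul {d : ℕ} (l : List (Vd d)) (F : Vd d → ℝ) (b : ℝ) :
    DD l (fun x => b * F x) = fun x => b * DD l F x := by
  induction l with
  | nil => rfl
  | cons v l ih => ext x; simp only [DD, ih]; ring

theorem DD_sum {d : ℕ} {ι : Type*} (s : Finset ι) (l : List (Vd d)) (F : ι → Vd d → ℝ)
    (b : ι → ℝ) :
    DD l (fun x => ∑ i ∈ s, b i * F i x) = fun x => ∑ i ∈ s, b i * DD l (F i) x := by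
  classical
  induction s using Finset.induction_on with
  | empty => simp [DD_zero]
  | insert a s ha ih =>
    simp only [Finset.sum_insert ha]
    rw [DD_add, DD_smul, ih]

/-- the product of the `1 - e^{⟨ξ,v⟩}` -/
noncomputable def ev {d : ℕ} (l : List (Vd d)) (ξ : Vd d) : ℝ :=
  (l.map fun v => 1 - Real.exp (pairE ξ v)).prod

theorem ev_append {d : ℕ} (l₁ l₂ : List (Vd d)) (ξ : Vd d) :
    ev (l₁ ++ l₂) ξ = ev l₁ ξ * ev l₂ ξ := by simp [ev]

theorem ev_ne_zero {d : ℕ} (l : List (Vd d)) (ξ : Vd d) (h : ∀ v ∈ l, pairE ξ v ≠ 0) :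
    ev l ξ ≠ 0 := by
  rw [ev]
  apply List.prod_ne_zero
  simp only [List.mem_map, not_exists, not_and]
  intro v hv h0
  apply h v hv
  have : Real.exp (pairE ξ v) = 1 := by linarith
  simpa using this

/-- invariance and local finiteness of the measure -/
structure Good {d : ℕ} (ν : Measure (Vd d)) (l : Set (Vd d)) : Prop where
  fin : ∀ B : Set (Vd d), Bornology.IsBounded B → ν B < ⊤
  inv : ∀ v ∈ l, MeasurePreserving (fun x => x - v) ν ν

theorem DD_ae_zero {d : ℕ} {ν : Measure (Vd d)} {L : Set (Vd d)} (hν : Good ν L)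
    (l : List (Vd d)) (hl : ∀ v ∈ l, v ∈ L) (F : Vd d → ℝ) (hF : ∀ᵐ x ∂ν, F x = 0) :
    ∀ᵐ x ∂ν, DD l F x = 0 := by
  induction l with
  | nil => exact hF
  | cons v l ih =>
    have h1 := ih fun w hw => hl w (by simp [hw])
    have h2 := (hν.inv v (hl v (by simp))).quasiMeasurePreserving.ae h1
    filter_upwards [h1, h2] with x a b
    simp only [DD, a, b, sub_zero]

theorem measurableEmbedding_sub {d : ℕ} (v : Vd d) :
    MeasurableEmbedding (fun x : Vd d => x - v) := by
  simpa [sub_eq_add_neg] using measurableEmbedding_addRight (-v)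

theorem DD_int {d : ℕ} {ν : Measure (Vd d)} {L : Set (Vd d)} (hν : Good ν L)
    (l : List (Vd d)) (hl : ∀ v ∈ l, v ∈ L) (F : Vd d → ℝ) (ξ : Vd d)
    (hF : Integrable (fun x => F x * Real.exp (pairE ξ x)) ν) :
    Integrable (fun x => DD l F x * Real.exp (pairE ξ x)) ν ∧
    ∫ x, DD l F x * Real.exp (pairE ξ x) ∂ν = ev l ξ * ∫ x, F x * Real.exp (pairE ξ x) ∂ν := by
  induction l with
  | nil => exact ⟨hF, by simp [DD, ev]⟩
  | cons v l ih =>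
    obtain ⟨h1, h2⟩ := ih fun w hw => hl w (by simp [hw])
    have hp := hν.inv v (hl v (by simp))
    have h3 : Integrable (fun x => DD l F (x - v) * Real.exp (pairE ξ (x - v))) ν :=
      (hp.integrable_comp_emb (measurableEmbedding_sub v)).2 h1
    have h4 : ∫ x, DD l F (x - v) * Real.exp (pairE ξ (x - v)) ∂ν
        = ∫ x, DD l F x * Real.exp (pairE ξ x) ∂ν :=
      hp.integral_comp (measurableEmbedding_sub v)
        (fun x => DD l F x * Real.exp (pairE ξ x))
    have h5 : (fun x => DD (v :: l) F x * Real.exp (pairE ξ x)) = fun x =>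
        DD l F x * Real.exp (pairE ξ x) -
          Real.exp (pairE ξ v) * (DD l F (x - v) * Real.exp (pairE ξ (x - v))) := by
      ext x
      have : Real.exp (pairE ξ x) = Real.exp (pairE ξ v) * Real.exp (pairE ξ (x - v)) := by
        rw [← Real.exp_add, pairE_sub_right]; congr 1; ring
      simp only [DD]; rw [sub_mul]; congr 1
      rw [this]; ring
    rw [h5]
    refine ⟨h1.sub (h3.const_mul _), ?_⟩
    rw [integral_sub h1 (h3.const_mul _), integral_const_mul, h4, h2]
    simp only [ev, List.map_cons, List.prod_cons]; ring

/-- pointwise linearity -/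
theorem val_zero {d : ℕ} {ν : Measure (Vd d)} {L : Set (Vd d)} (hν : Good ν L)
    {ι : Type*} (s : Finset ι) (l : ι → List (Vd d)) (hl : ∀ i ∈ s, ∀ v ∈ l i, v ∈ L)
    (F : ι → Vd d → ℝ) (ξ : Vd d) (f b : ι → ℝ)
    (hint : ∀ i ∈ s, Integrable (fun x => DD (l i) (F i) x * Real.exp (pairE ξ x)) ν)
    (hf : ∀ i ∈ s, f i * ev (l i) ξ = ∫ x, DD (l i) (F i) x * Real.exp (pairE ξ x) ∂ν)
    (hev : ∀ i ∈ s, ev (l i) ξ ≠ 0)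
    (hrel : ∀ᵐ x ∂ν, ∑ i ∈ s, b i * F i x = 0) :
    ∑ i ∈ s, b i * f i = 0 := by
  classical
  -- a list containing all `l i`
  obtain ⟨M, hM, hMev, hMl⟩ : ∃ M : List (Vd d), (∀ v ∈ M, v ∈ L) ∧ ev M ξ ≠ 0 ∧
      ∀ i ∈ s, ∃ l', M.Perm (l' ++ l i) := by
    clear hint hf hrel
    induction s using Finset.induction_on with
    | empty => exact ⟨[], by simp, by simp [ev], by simp⟩
    | insert a s ha ih =>
      obtain ⟨M, h1, h2, h3⟩ := ih (fun i hi => hl i (by simp [hi])) (fun i hi => hev i (by simp [hi]))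
      refine ⟨M ++ l a, ?_, ?_, ?_⟩
      · intro v hv
        rcases List.mem_append.1 hv with h | h
        · exact h1 v h
        · exact hl a (by simp) v h
      · rw [ev_append]; exact mul_ne_zero h2 (hev a (by simp))
      · intro i hi
        rcases Finset.mem_insert.1 hi with rfl | hi
        · exact ⟨M, List.Perm.refl _⟩
        · obtain ⟨l', hl'⟩ := h3 i hi
          refine ⟨l a ++ l', ?_⟩
          rw [List.append_assoc]
          exact List.perm_append_comm.trans (hl'.append_left _)
  have key : ∀ i ∈ s, Integrable (fun x => DD M (F i) x * Real.exp (pairE ξ x)) ν ∧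
      ∫ x, DD M (F i) x * Real.exp (pairE ξ x) ∂ν = ev M ξ * f i := by
    intro i hi
    obtain ⟨l', hl'⟩ := hMl i hi
    rw [DD_perm hl', DD_append]
    have hh := DD_int hν l' (fun v hv => hM v (hl'.symm.subset (by simp [hv]))) _ ξ (hint i hi)
    refine ⟨hh.1, ?_⟩
    rw [hh.2, ← hf i hi]
    have : ev M ξ = ev l' ξ * ev (l i) ξ := by
      rw [← ev_append]; exact (hl'.map _).prod_eq
    rw [this]; ring
  have hz := DD_ae_zero hν M hM _ hrel
  rw [DD_sum] at hz
  have h0 : ∫ x, ∑ i ∈ s, b i * (DD M (F i) x * Real.exp (pairE ξ x)) ∂ν = 0 := by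
    rw [integral_eq_zero_of_ae]
    filter_upwards [hz] with x hx
    have : ∑ i ∈ s, b i * (DD M (F i) x * Real.exp (pairE ξ x))
        = (∑ i ∈ s, b i * DD M (F i) x) * Real.exp (pairE ξ x) := by
      rw [Finset.sum_mul]; exact Finset.sum_congr rfl fun i _ => by ring
    rw [this, hx]; simp
  rw [integral_finsetSum s (fun i hi => (key i hi).1.const_mul _)] at h0
  have : ∑ i ∈ s, ∫ x, b i * (DD M (F i) x * Real.exp (pairE ξ x)) ∂ν
      = ev M ξ * ∑ i ∈ s, b i * f i := by
    rw [Finset.mul_sum]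
    refine Finset.sum_congr rfl fun i hi => ?_
    rw [integral_const_mul, (key i hi).2]; ring
  rw [this] at h0
  exact (mul_eq_zero.1 h0).resolve_left hMev

open MeasureTheory Filter Topology Set
open scoped RealInnerProductSpace Pointwise BigOperators

/-! ### Finitely generated cones -/

/-- the cone generated by a finite set -/
def cone {d : ℕ} (T : Finset (Vd d)) : Set (Vd d) :=
  {x | ∃ t : Vd d → ℝ, (∀ v ∈ T, 0 ≤ t v) ∧ x = ∑ v ∈ T, t v • v}

theorem cone_zero_mem {d : ℕ} (T : Finset (Vd d)) : (0 : Vd d) ∈ cone T :=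
  ⟨fun _ => 0, by simp, by simp⟩

theorem cone_add_mem {d : ℕ} {T : Finset (Vd d)} {x y : Vd d} (hx : x ∈ cone T)
    (hy : y ∈ cone T) : x + y ∈ cone T := by
  obtain ⟨t, ht, rfl⟩ := hx
  obtain ⟨u, hu, rfl⟩ := hy
  refine ⟨fun v => t v + u v, fun v hv => add_nonneg (ht v hv) (hu v hv), ?_⟩
  simp [add_smul, Finset.sum_add_distrib]

theorem cone_smul_mem {d : ℕ} {T : Finset (Vd d)} {x : Vd d} (hx : x ∈ cone T) {a : ℝ}
    (ha : 0 ≤ a) : a • x ∈ cone T := by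
  obtain ⟨t, ht, rfl⟩ := hx
  refine ⟨fun v => a * t v, fun v hv => mul_nonneg ha (ht v hv), ?_⟩
  simp [Finset.smul_sum, smul_smul]

theorem cone_gen_mem {d : ℕ} {T : Finset (Vd d)} {v : Vd d} (hv : v ∈ T) : v ∈ cone T := by
  classical
  refine ⟨fun w => if w = v then 1 else 0, fun w _ => by dsimp only; split_ifs <;> norm_num, ?_⟩
  simp [ite_smul, hv]

theorem cone_sum_mem {d : ℕ} {T : Finset (Vd d)} {ι : Type*} (s : Finset ι) (f : ι → Vd d)
    (h : ∀ i ∈ s, f i ∈ cone T) : ∑ i ∈ s, f i ∈ cone T := by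
  classical
  induction s using Finset.induction_on with
  | empty => simpa using cone_zero_mem T
  | insert a s ha ih =>
    rw [Finset.sum_insert ha]
    exact cone_add_mem (h a (by simp)) (ih fun i hi => h i (by simp [hi]))

theorem cone_convex {d : ℕ} (T : Finset (Vd d)) : Convex ℝ (cone T) := by
  intro x hx y hy a b ha hb _
  exact cone_add_mem (cone_smul_mem hx ha) (cone_smul_mem hy hb)

theorem cone_mono {d : ℕ} {T T' : Finset (Vd d)} (h : T ⊆ T') : cone T ⊆ cone T' := by
  rintro x ⟨t, ht, rfl⟩
  exact cone_sum_mem _ _ fun v hv => cone_smul_mem (cone_gen_mem (h hv)) (ht v hv)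

theorem cone_subset_span {d : ℕ} (T : Finset (Vd d)) :
    cone T ⊆ Submodule.span ℝ (T : Set (Vd d)) := by
  rintro x ⟨t, _, rfl⟩
  exact Submodule.sum_mem _ fun v hv => Submodule.smul_mem _ _ (Submodule.subset_span hv)

theorem cone_insert {d : ℕ} [DecidableEq (Vd d)] (T : Finset (Vd d)) (v x : Vd d) :
    x ∈ cone (insert v T) ↔ ∃ t : ℝ, 0 ≤ t ∧ x - t • v ∈ cone T := by
  constructor
  · rintro ⟨t, ht, rfl⟩
    by_cases hv : v ∈ T
    · refine ⟨0, le_rfl, ?_⟩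
      rw [Finset.insert_eq_of_mem hv] at ht ⊢
      simpa using ⟨t, ht, rfl⟩
    · refine ⟨t v, ht v (by simp), t, fun w hw => ht w (by simp [hw]), ?_⟩
      rw [Finset.sum_insert hv]; abel
  · rintro ⟨t, ht, h⟩
    have h1 := cone_mono (Finset.subset_insert v T) h
    have h2 := cone_smul_mem (cone_gen_mem (Finset.mem_insert_self v T)) ht
    have := cone_add_mem h1 h2
    simpa using this

theorem cone_of_fin {d : ℕ} {n : ℕ} (v : Fin n → Vd d) :
    ∃ T : Finset (Vd d), (∀ w ∈ T, w ≠ 0 ∧ ∃ i, w = v i) ∧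
    {x | ∃ t : Fin n → ℝ, (∀ i, 0 ≤ t i) ∧ x = ∑ i, t i • v i} = cone T := by
  classical
  refine ⟨(Finset.univ.image v).filter (· ≠ 0), ?_, ?_⟩
  · intro w hw
    simp only [Finset.mem_filter, Finset.mem_image, Finset.mem_univ, true_and] at hw
    exact ⟨hw.2, hw.1.imp fun i h => h.symm⟩
  · ext x
    constructor
    · rintro ⟨t, ht, rfl⟩
      refine cone_sum_mem _ _ fun i _ => ?_
      by_cases h : v i = 0
      · rw [h, smul_zero]; exact cone_zero_mem _
      · exact cone_smul_mem (cone_gen_mem (by simp [h])) (ht i)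
    · rintro ⟨t, ht, rfl⟩
      set S := (Finset.univ.image v).filter (· ≠ 0)
      have : ∀ w : Vd d, ∃ i : Fin n → ℝ, w ∈ S → (∀ j, 0 ≤ i j) ∧ t w • w = ∑ j, i j • v j := by
        intro w
        by_cases hw : w ∈ S
        · have hw' := hw
          simp only [S, Finset.mem_filter, Finset.mem_image, Finset.mem_univ, true_and] at hw'
          obtain ⟨⟨i, hi⟩, _⟩ := hw'
          refine ⟨fun j => if j = i then t w else 0, fun _ => ⟨fun j => ?_, ?_⟩⟩
          · dsimp only; split_ifs
            · exact ht w hw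
            · exact le_rfl
          · simp [ite_smul, hi]
        · exact ⟨0, fun h => absurd h hw⟩
      choose f hf using this
      refine ⟨fun j => ∑ w ∈ S, f w j, fun j => Finset.sum_nonneg fun w hw => (hf w hw).1 j, ?_⟩
      simp_rw [Finset.sum_smul]
      rw [Finset.sum_comm]
      exact Finset.sum_congr rfl fun w hw => (hf w hw).2

theorem fin_of_cone {d : ℕ} (T : Finset (Vd d)) :
    ∃ (n : ℕ) (v : Fin n → Vd d), (∀ i, v i ∈ T) ∧
    cone T = {x | ∃ t : Fin n → ℝ, (∀ i, 0 ≤ t i) ∧ x = ∑ i, t i • v i} := by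
  classical
  refine ⟨T.card, fun i => (T.equivFin.symm i : Vd d), fun i => (T.equivFin.symm i).2, ?_⟩
  ext x
  constructor
  · rintro ⟨t, ht, rfl⟩
    refine ⟨fun i => t (T.equivFin.symm i), fun i => ht _ (T.equivFin.symm i).2, ?_⟩
    rw [Equiv.sum_comp T.equivFin.symm (fun w : T => t w • (w : Vd d))]
    rw [Finset.sum_coe_sort T (fun w => t w • w)]
  · rintro ⟨t, ht, rfl⟩
    exact cone_sum_mem _ _ fun i _ => cone_smul_mem (cone_gen_mem (T.equivFin.symm i).2) (ht i)

theorem ratCone_iff {d : ℕ} (Λ : AddSubgroup (Vd d)) (c : Set (Vd d)) (h : IsRatCone Λ c) :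
    ∃ T : Finset (Vd d), (∀ w ∈ T, w ≠ 0 ∧ w ∈ Λ) ∧ c = cone T := by
  obtain ⟨n, v, hv, rfl⟩ := h
  obtain ⟨T, h1, h2⟩ := cone_of_fin v
  refine ⟨T, fun w hw => ⟨(h1 w hw).1, ?_⟩, h2⟩
  obtain ⟨i, rfl⟩ := (h1 w hw).2
  exact hv i

theorem ratCone_cone {d : ℕ} {Λ : AddSubgroup (Vd d)} {T : Finset (Vd d)}
    (hT : ∀ w ∈ T, w ∈ Λ) : IsRatCone Λ (cone T) := by
  obtain ⟨n, v, hv, h⟩ := fin_of_cone T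
  exact ⟨n, v, fun i => hT _ (hv i), h⟩

theorem ratAffine_of_ratCone {d : ℕ} {Λ : AddSubgroup (Vd d)} {c : Set (Vd d)} {s : Vd d}
    (hs : IsRatPoint Λ s) (hc : IsRatCone Λ c) :
    IsRatAffineCone Λ ((fun x => s + x) '' c) := by
  obtain ⟨n, v, hv, rfl⟩ := hc
  refine ⟨s, n, v, hs, hv, ?_⟩
  ext x
  constructor
  · rintro ⟨_, ⟨t, ht, rfl⟩, rfl⟩; exact ⟨t, ht, rfl⟩
  · rintro ⟨t, ht, rfl⟩; exact ⟨_, ⟨t, ht, rfl⟩, rfl⟩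

/-! ### Rational Weyl theorem -/

theorem dualIntegral_comb {d : ℕ} {Λ : AddSubgroup (Vd d)} {φ ψ : Vd d} (hφ : IsDualIntegral Λ φ)
    (hψ : IsDualIntegral Λ ψ) (a b : ℤ) : IsDualIntegral Λ ((a : ℝ) • φ + (b : ℝ) • ψ) := by
  intro x hx
  obtain ⟨n, hn⟩ := hφ x hx
  obtain ⟨m, hm⟩ := hψ x hx
  exact ⟨a * n + b * m, by rw [pairE_add_left, pairE_smul_left, pairE_smul_left, hn, hm]; push_cast; ring⟩

theorem span_lattice {d : ℕ} {k : ℕ} (v : Fin k → Vd d) :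
    Submodule.span ℝ ((AddSubgroup.closure (Set.range v) : AddSubgroup (Vd d)) : Set (Vd d))
      = Submodule.span ℝ (Set.range v) := by
  apply le_antisymm
  · rw [Submodule.span_le]
    intro x hx
    have : AddSubgroup.closure (Set.range v) ≤ (Submodule.span ℝ (Set.range v)).toAddSubgroup := by
      rw [AddSubgroup.closure_le]; exact Submodule.subset_span
    exact this hx
  · exact Submodule.span_mono AddSubgroup.subset_closure

/-- linear functionals are represented by `pairE` -/
theorem exists_rep {d : ℕ} (f : Vd d →ₗ[ℝ] ℝ) : ∃ φ : Vd d, ∀ x, pairE φ x = f x := by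
  refine ⟨(InnerProductSpace.toDual ℝ (Vd d)).symm (LinearMap.toContinuousLinearMap f), fun x => ?_⟩
  simp [pairE]

/-- the trivial cone -/
theorem weyl_base {d : ℕ} {Λ : AddSubgroup (Vd d)} (hΛ : IsLatticeSub Λ) :
    ∃ Φ : Finset (Vd d), (∀ φ ∈ Φ, IsDualIntegral Λ φ) ∧
    ({0} : Set (Vd d)) = {x | x ∈ Submodule.span ℝ (Λ : Set (Vd d)) ∧ ∀ φ ∈ Φ, pairE φ x ≤ 0} := by
  classical
  obtain ⟨k, v, hv, rfl⟩ := hΛ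
  have h1 : ∀ i : Fin k, ∃ φ : Vd d, ∀ j, pairE φ (v j) = if j = i then 1 else 0 := by
    intro i
    obtain ⟨f, hf⟩ := (hv.linearCombination_repr) |> fun _ =>
      LinearMap.exists_extend ((Finsupp.lapply i).comp hv.repr)
    obtain ⟨φ, hφ⟩ := exists_rep f
    refine ⟨φ, fun j => ?_⟩
    have hm : v j ∈ Submodule.span ℝ (Set.range v) := Submodule.subset_span ⟨j, rfl⟩
    have := LinearMap.congr_fun hf ⟨v j, hm⟩
    rw [hφ]
    simp only [LinearMap.comp_apply, Submodule.subtype_apply] at this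
    rw [this]
    have hr : hv.repr ⟨v j, hm⟩ = Finsupp.single j 1 := hv.repr_eq_single j ⟨v j, hm⟩ rfl
    show (hv.repr ⟨v j, hm⟩) i = _
    rw [hr, Finsupp.single_apply]
  choose φ hφ using h1
  have hint : ∀ i, IsDualIntegral (AddSubgroup.closure (Set.range v)) (φ i) := by
    intro i x hx
    induction hx using AddSubgroup.closure_induction with
    | mem x hx =>
      obtain ⟨j, rfl⟩ := hx
      rw [hφ]
      exact ⟨if j = i then 1 else 0, by split_ifs <;> simp⟩
    | zero => exact ⟨0, by simp [pairE_zero_right]⟩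
    | add x y _ _ h1 h2 =>
      obtain ⟨n, hn⟩ := h1
      obtain ⟨m, hm⟩ := h2
      exact ⟨n + m, by rw [pairE_add_right, hn, hm]; push_cast; ring⟩
    | neg x _ h =>
      obtain ⟨n, hn⟩ := h
      refine ⟨-n, ?_⟩
      have : pairE (φ i) (-x) = - pairE (φ i) x := by simp [pairE]
      rw [this, hn]; push_cast; ring
  refine ⟨(Finset.univ.image φ) ∪ (Finset.univ.image fun i => - φ i), ?_, ?_⟩
  · intro ψ hψ
    simp only [Finset.mem_union, Finset.mem_image, Finset.mem_univ, true_and] at hψ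
    rcases hψ with ⟨i, rfl⟩ | ⟨i, rfl⟩
    · exact hint i
    · intro x hx
      obtain ⟨n, hn⟩ := hint i x hx
      exact ⟨-n, by rw [pairE_neg_left, hn]; push_cast; ring⟩
  · ext x
    rw [span_lattice]
    constructor
    · rintro rfl
      exact ⟨Submodule.zero_mem _, fun ψ _ => by simp [pairE_zero_right]⟩
    · rintro ⟨hx, h⟩
      obtain ⟨t, rfl⟩ := (Submodule.mem_span_range_iff_exists_fun ℝ).1 hx
      have hc : ∀ i, pairE (φ i) (∑ j, t j • v j) = t i := by
        intro i
        rw [pairE_sum_right]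
        simp [pairE_smul_right, hφ]
      have h0 : ∀ i, t i = 0 := by
        intro i
        have a := h (φ i) (by simp)
        have b := h (-φ i) (by simp)
        rw [pairE_neg_left] at b
        rw [hc] at a b
        linarith
      simp [h0]

/-- Fourier-Motzkin elimination -/
theorem weyl {d : ℕ} {Λ : AddSubgroup (Vd d)} (hΛ : IsLatticeSub Λ) (T : Finset (Vd d))
    (hT : ∀ v ∈ T, v ∈ Λ) :
    ∃ Φ : Finset (Vd d), (∀ φ ∈ Φ, IsDualIntegral Λ φ) ∧
    cone T = {x | x ∈ Submodule.span ℝ (Λ : Set (Vd d)) ∧ ∀ φ ∈ Φ, pairE φ x ≤ 0} := by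
  classical
  induction T using Finset.induction_on with
  | empty =>
    obtain ⟨Φ, h1, h2⟩ := weyl_base hΛ
    refine ⟨Φ, h1, ?_⟩
    rw [← h2]; ext x; simp [cone]
  | insert v T hvT ih =>
    obtain ⟨Φ, h1, h2⟩ := ih fun w hw => hT w (by simp [hw])
    have hvΛ := hT v (by simp)
    have hvs : v ∈ Submodule.span ℝ (Λ : Set (Vd d)) := Submodule.subset_span hvΛ
    set N := Φ.filter fun φ => pairE φ v ≤ 0 with hN
    set P := Φ.filter fun φ => 0 < pairE φ v with hP
    refine ⟨N ∪ (N ×ˢ P).image (fun q => (-(pairE q.1 v)) • q.2 + (pairE q.2 v) • q.1), ?_, ?_⟩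
    · intro ψ hψ
      simp only [Finset.mem_union, Finset.mem_image, Finset.mem_product] at hψ
      rcases hψ with h | ⟨⟨m, p⟩, ⟨hm, hp⟩, rfl⟩
      · exact h1 _ (Finset.mem_filter.1 h).1
      · have hm' := h1 m (Finset.mem_filter.1 hm).1
        have hp' := h1 p (Finset.mem_filter.1 hp).1
        obtain ⟨a, ha⟩ := hm' v hvΛ
        obtain ⟨b, hb⟩ := hp' v hvΛ
        have := dualIntegral_comb hp' hm' (-a) b
        simp only [ha, hb]
        simpa using this
    · ext x
      rw [cone_insert, h2]
      simp only [Set.mem_ofPred_eq]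
      constructor
      · rintro ⟨t, ht, hx, h⟩
        have hxs : x ∈ Submodule.span ℝ (Λ : Set (Vd d)) := by
          have := Submodule.add_mem _ hx (Submodule.smul_mem _ t hvs)
          simpa using this
        have h' : ∀ φ ∈ Φ, pairE φ x ≤ t * pairE φ v := by
          intro φ hφ
          have := h φ hφ
          rw [pairE_sub_right, pairE_smul_right] at this
          linarith
        refine ⟨hxs, fun ψ hψ => ?_⟩
        simp only [Finset.mem_union, Finset.mem_image, Finset.mem_product] at hψ
        rcases hψ with hψ | ⟨⟨m, p⟩, ⟨hm, hp⟩, rfl⟩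
        · have := h' ψ (Finset.mem_filter.1 hψ).1
          have := (Finset.mem_filter.1 hψ).2
          nlinarith
        · have a := h' m (Finset.mem_filter.1 hm).1
          have b := h' p (Finset.mem_filter.1 hp).1
          have a' := (Finset.mem_filter.1 hm).2
          have b' := (Finset.mem_filter.1 hp).2
          rw [pairE_add_left, pairE_smul_left, pairE_smul_left]
          simp only at *
          nlinarith [mul_le_mul_of_nonneg_left a b'.le,
            mul_le_mul_of_nonneg_left b (neg_nonneg.2 a')]
      · rintro ⟨hxs, h⟩
        have hm0 : ∀ m ∈ N, pairE m x ≤ 0 := fun m hm => h m (by simp [hm])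
        have hmp : ∀ m ∈ N, ∀ p ∈ P, -(pairE m v) * pairE p x + pairE p v * pairE m x ≤ 0 := by
          intro m hm p hp
          have := h ((-(pairE m v)) • p + (pairE p v) • m)
            (Finset.mem_union_right _ (Finset.mem_image.2 ⟨(m, p), by simp [hm, hp], rfl⟩))
          rwa [pairE_add_left, pairE_smul_left, pairE_smul_left] at this
        -- choose t
        obtain ⟨t, ht0, htp, htm⟩ : ∃ t : ℝ, 0 ≤ t ∧ (∀ p ∈ P, pairE p x ≤ t * pairE p v) ∧
            ∀ m ∈ N, pairE m x ≤ t * pairE m v := by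
          set f : Vd d → ℝ := fun p => pairE p x / pairE p v
          by_cases hex : ∃ p ∈ P, 0 < pairE p x
          · obtain ⟨p0, hp0, hp0x⟩ := hex
            obtain ⟨p1, hp1, hmax⟩ := Finset.exists_max_image P f ⟨p0, hp0⟩
            have hp1v := (Finset.mem_filter.1 hp1).2
            have hp0v := (Finset.mem_filter.1 hp0).2
            have hpos : 0 ≤ f p1 := le_trans (div_pos hp0x hp0v).le (hmax p0 hp0)
            refine ⟨f p1, hpos, fun p hp => ?_, fun m hm => ?_⟩
            · have hpv := (Finset.mem_filter.1 hp).2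
              have := hmax p hp
              exact (div_le_iff₀ hpv).1 this
            · have := hmp m hm p1 hp1
              have e : f p1 * pairE p1 v = pairE p1 x := by
                simp only [f]; field_simp
              by_contra hcon
              push Not at hcon
              have h4 := mul_lt_mul_of_pos_left hcon hp1v
              rw [← e] at this
              linarith
          · push Not at hex
            refine ⟨0, le_rfl, fun p hp => by simpa using hex p hp, fun m hm => ?_⟩
            simpa using hm0 m hm
        refine ⟨t, ht0, Submodule.sub_mem _ hxs (Submodule.smul_mem _ _ hvs), fun φ hφ => ?_⟩
        rw [pairE_sub_right, pairE_smul_right]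
        by_cases hv : pairE φ v ≤ 0
        · linarith [htm φ (Finset.mem_filter.2 ⟨hφ, hv⟩)]
        · linarith [htp φ (Finset.mem_filter.2 ⟨hφ, not_le.1 hv⟩)]

theorem cone_isClosed {d : ℕ} {Λ : AddSubgroup (Vd d)} (hΛ : IsLatticeSub Λ) (T : Finset (Vd d))
    (hT : ∀ v ∈ T, v ∈ Λ) : IsClosed (cone T) := by
  obtain ⟨Φ, _, h⟩ := weyl hΛ T hT
  rw [h]
  have : {x | x ∈ Submodule.span ℝ (Λ : Set (Vd d)) ∧ ∀ φ ∈ Φ, pairE φ x ≤ 0} =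
      (Submodule.span ℝ (Λ : Set (Vd d)) : Set (Vd d)) ∩ ⋂ φ ∈ Φ, {x | pairE φ x ≤ 0} := by
    ext x; simp
  rw [this]
  refine (Submodule.closed_of_finiteDimensional _).inter ?_
  exact isClosed_biInter fun φ _ => isClosed_le (continuous_pairE φ) continuous_const

theorem ratPoint_span {d : ℕ} {Λ : AddSubgroup (Vd d)} {s : Vd d} (hs : IsRatPoint Λ s) :
    s ∈ Submodule.span ℝ (Λ : Set (Vd d)) := by
  obtain ⟨q, hq, h⟩ := hs
  have : s = (q : ℝ)⁻¹ • ((q : ℝ) • s) := by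
    rw [smul_smul, inv_mul_cancel₀ (by exact_mod_cast hq), one_smul]
  rw [this]
  exact Submodule.smul_mem _ _ (Submodule.subset_span h)

theorem ratPoly_cone {d : ℕ} {Λ : AddSubgroup (Vd d)} (hΛ : IsLatticeSub Λ) (T : Finset (Vd d))
    (hT : ∀ v ∈ T, v ∈ Λ) {s : Vd d} (hs : IsRatPoint Λ s) :
    IsRatPolyhedron Λ ((fun x => s + x) '' cone T) := by
  obtain ⟨Φ, h1, h⟩ := weyl hΛ T hT
  have hsΛ := ratPoint_span hs
  have hrat : ∀ φ : Vd d, ∃ q : ℚ, φ ∈ Φ → pairE φ s = (q : ℝ) := by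
    intro φ
    by_cases hφ : φ ∈ Φ
    · obtain ⟨q, hq, hqs⟩ := hs
      obtain ⟨n, hn⟩ := h1 φ hφ _ hqs
      refine ⟨n / q, fun _ => ?_⟩
      rw [pairE_smul_right] at hn
      have : (q : ℝ) ≠ 0 := by exact_mod_cast hq
      push_cast
      rw [eq_div_iff this, ← hn]; ring
    · exact ⟨0, fun h => absurd h hφ⟩
  choose q hq using hrat
  refine ⟨Φ.card, fun i => (Φ.equivFin.symm i : Vd d), fun i => q (Φ.equivFin.symm i), ?_, ?_⟩
  · intro i; exact h1 _ (Φ.equivFin.symm i).2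
  · ext x
    rw [h]
    constructor
    · rintro ⟨y, ⟨hy, hy2⟩, rfl⟩
      refine ⟨Submodule.add_mem _ hsΛ hy, fun i => ?_⟩
      have := hy2 _ (Φ.equivFin.symm i).2
      rw [pairE_add_right, hq _ (Φ.equivFin.symm i).2]
      linarith
    · rintro ⟨hx, hx2⟩
      refine ⟨x - s, ⟨Submodule.sub_mem _ hx hsΛ, fun φ hφ => ?_⟩, by simp⟩
      have := hx2 (Φ.equivFin ⟨φ, hφ⟩)
      simp only [Equiv.symm_apply_apply] at this
      rw [pairE_sub_right, hq φ hφ]; linarith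

/-! ### Pointed cones -/

/-- `c` contains a line through the origin -/
theorem containsLine_cone {d : ℕ} {Λ : AddSubgroup (Vd d)} (hΛ : IsLatticeSub Λ)
    (T : Finset (Vd d)) (hT : ∀ v ∈ T, v ∈ Λ) (s : Vd d)
    (h : ContainsLine ((fun x => s + x) '' cone T)) : ∃ u ≠ 0, u ∈ cone T ∧ -u ∈ cone T := by
  obtain ⟨x, u, hu, hl⟩ := h
  have hl' : ∀ t : ℝ, (x - s) + t • u ∈ cone T := by
    intro t
    obtain ⟨y, hy, e⟩ := hl t
    have : (x - s) + t • u = y := by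
      rw [sub_add_eq_add_sub, ← e]; simp
    rwa [this]
  obtain ⟨Φ, _, h⟩ := weyl hΛ T hT
  rw [h] at hl'
  have hsp : u ∈ Submodule.span ℝ (Λ : Set (Vd d)) := by
    have := Submodule.sub_mem _ (hl' 1).1 (hl' 0).1
    simpa using this
  have hz : ∀ φ ∈ Φ, pairE φ u = 0 := by
    intro φ hφ
    by_contra hne
    have := (hl' ((1 - pairE φ (x - s)) / pairE φ u)).2 φ hφ
    rw [pairE_add_right, pairE_smul_right, div_mul_cancel₀ _ hne] at this
    linarith
  refine ⟨u, hu, ?_, ?_⟩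
  · rw [h]; exact ⟨hsp, fun φ hφ => (hz φ hφ).le⟩
  · rw [h]; refine ⟨Submodule.neg_mem _ hsp, fun φ hφ => ?_⟩
    have : pairE φ (-u) = - pairE φ u := by simp [pairE]
    rw [this, hz φ hφ]; simp

theorem containsLine_of {d : ℕ} (T : Finset (Vd d)) (s : Vd d) {u : Vd d} (hu : u ≠ 0)
    (h1 : u ∈ cone T) (h2 : -u ∈ cone T) : ContainsLine ((fun x => s + x) '' cone T) := by
  refine ⟨s, u, hu, fun t => ⟨t • u, ?_, rfl⟩⟩
  rcases le_total 0 t with ht | ht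
  · exact cone_smul_mem h1 ht
  · have := cone_smul_mem h2 (neg_nonneg.2 ht)
    simpa using this

/-- Gordan alternative -/
theorem gordan {d : ℕ} (T : Finset (Vd d)) :
    (∃ v ∈ T, -v ∈ cone T) ∨ ∃ ξ : Vd d, ∀ v ∈ T, pairE ξ v < 0 := by
  classical
  by_cases h0 : (0 : Vd d) ∈ convexHull ℝ (T : Set (Vd d))
  · left
    rw [Finset.mem_convexHull'] at h0
    obtain ⟨w, hw, hw1, hw2⟩ := h0
    obtain ⟨v, hv, hv0⟩ : ∃ v ∈ T, 0 < w v := by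
      by_contra hcon
      push Not at hcon
      have := Finset.sum_nonpos hcon
      linarith
    refine ⟨v, hv, ?_⟩
    have e : -v = (w v)⁻¹ • ∑ y ∈ T.erase v, w y • y := by
      have := Finset.add_sum_erase T (fun y => w y • y) hv
      rw [hw2] at this
      have h3 : ∑ y ∈ T.erase v, w y • y = - (w v • v) := by
        rw [eq_neg_iff_add_eq_zero, add_comm]; exact this
      rw [h3, smul_neg, smul_smul, inv_mul_cancel₀ hv0.ne', one_smul]
    rw [e]
    refine cone_smul_mem (cone_sum_mem _ _ fun y hy => ?_) (inv_nonneg.2 hv0.le)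
    have hy' := (Finset.mem_erase.1 hy).2
    exact cone_smul_mem (cone_gen_mem hy') (hw y hy')
  · right
    have hcl : IsClosed (convexHull ℝ (T : Set (Vd d))) :=
      (T.finite_toSet.isCompact_convexHull (E := Vd d) (𝕜 := ℝ)).isClosed
    obtain ⟨f, u, h1, h2⟩ := geometric_hahn_banach_point_closed (convex_convexHull ℝ _) hcl h0
    obtain ⟨φ, hφ⟩ := exists_rep (-(f : Vd d →ₗ[ℝ] ℝ))
    refine ⟨φ, fun v hv => ?_⟩
    have := h2 v (subset_convexHull ℝ _ hv)
    rw [hφ]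
    simp only [map_zero] at h1
    simp only [LinearMap.neg_apply, ContinuousLinearMap.coe_coe]
    linarith

open MeasureTheory Filter Topology Set
open scoped RealInnerProductSpace Pointwise BigOperators ENNReal

/-! ### Bounded support of the difference -/

theorem DD_ne_zero {d : ℕ} (l : List (Vd d)) (F : Vd d → ℝ) (x : Vd d) (h : DD l F x ≠ 0) :
    ∃ l' : List (Vd d), l'.Sublist l ∧ F (x - l'.sum) ≠ 0 := by
  induction l generalizing x with
  | nil => exact ⟨[], by simp, by simpa [DD] using h⟩
  | cons v l ih =>
    by_cases h1 : DD l F x = 0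
    · have h2 : DD l F (x - v) ≠ 0 := by
        intro h2; apply h; simp [DD, h1, h2]
      obtain ⟨l', h3, h4⟩ := ih _ h2
      refine ⟨v :: l', h3.cons_cons v, ?_⟩
      simpa [sub_sub] using h4
    · obtain ⟨l', h3, h4⟩ := ih _ h1
      exact ⟨l', h3.cons v, h4⟩

theorem DD_shift {d : ℕ} (l : List (Vd d)) (F : Vd d → ℝ) (v x : Vd d) :
    DD l (fun y => F y - F (y - v)) x = DD l F x - DD l F (x - v) := by
  induction l generalizing x with
  | nil => rfl
  | cons w l ih => simp only [DD, ih]; rw [sub_right_comm x w v]; ring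

theorem DD_eq_zero {d : ℕ} [DecidableEq (Vd d)] (l : List (Vd d)) (F : Vd d → ℝ) (v x : Vd d)
    (hv : v ∈ l) (h : ∀ l' : List (Vd d), l'.Sublist (l.erase v) → F (x - l'.sum) = F (x - l'.sum - v)) :
    DD l F x = 0 := by
  rw [DD_perm (List.perm_cons_erase hv)]
  by_contra hne
  have : DD (l.erase v) (fun y => F y - F (y - v)) x ≠ 0 := by
    rw [DD_shift]; exact hne
  obtain ⟨l', h1, h2⟩ := DD_ne_zero _ _ _ this
  exact h2 (sub_eq_zero.2 (h l' h1))

noncomputable def chi {d : ℕ} (s : Vd d) (T : Finset (Vd d)) : Vd d → ℝ :=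
  Set.indicator ((fun x => s + x) '' cone T) (fun _ => 1)

theorem mem_tr {d : ℕ} (s : Vd d) (A : Set (Vd d)) (x : Vd d) :
    x ∈ (fun x => s + x) '' A ↔ x - s ∈ A := by
  constructor
  · rintro ⟨y, hy, rfl⟩; simpa using hy
  · intro h; exact ⟨x - s, h, by simp⟩

theorem chi_congr {d : ℕ} {s : Vd d} {T : Finset (Vd d)} {x y : Vd d}
    (h : x - s ∈ cone T ↔ y - s ∈ cone T) : chi s T x = chi s T y := by
  unfold chi
  by_cases hx : x - s ∈ cone T
  · rw [Set.indicator_of_mem ((mem_tr _ _ _).2 hx), Set.indicator_of_mem ((mem_tr _ _ _).2 (h.1 hx))]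
  · rw [Set.indicator_of_notMem (fun h' => hx ((mem_tr _ _ _).1 h')),
      Set.indicator_of_notMem (fun h' => hx (h.2 ((mem_tr _ _ _).1 h')))]

theorem chi_ne {d : ℕ} {s : Vd d} {T : Finset (Vd d)} {x : Vd d} (h : chi s T x ≠ 0) :
    x - s ∈ cone T := by
  by_contra hx
  exact h (Set.indicator_of_notMem (fun h' => hx ((mem_tr _ _ _).1 h')) _)

theorem list_sum_mem_cone {d : ℕ} {T : Finset (Vd d)} (l : List (Vd d)) (h : ∀ v ∈ l, v ∈ T) :
    l.sum ∈ cone T := by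
  induction l with
  | nil => simpa using cone_zero_mem T
  | cons v l ih =>
    rw [List.sum_cons]
    exact cone_add_mem (cone_gen_mem (h v (by simp))) (ih fun w hw => h w (by simp [hw]))

theorem DD_line {d : ℕ} (T : Finset (Vd d)) (s : Vd d) {v : Vd d} (hv : v ∈ T)
    (hv' : -v ∈ cone T) (x : Vd d) : DD T.toList (chi s T) x = 0 := by
  classical
  refine DD_eq_zero _ _ v x (by simpa using hv) fun l' _ => chi_congr ?_
  constructor
  · intro h
    have := cone_add_mem h hv'
    convert this using 1; abel
  · intro h
    have := cone_add_mem h (cone_gen_mem hv)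
    convert this using 1; abel

theorem pairE_list_sum {d : ℕ} (φ : Vd d) (l : List (Vd d)) :
    pairE φ l.sum = (l.map (pairE φ)).sum := by
  induction l with
  | nil => simp [pairE_zero_right]
  | cons v l ih => simp [pairE_add_right, ih]

theorem sublist_le {d : ℕ} (φ : Vd d) {l l' : List (Vd d)} (h : l'.Sublist l)
    (hn : ∀ v ∈ l, pairE φ v ≤ 0) : pairE φ l.sum ≤ pairE φ l'.sum := by
  induction h with
  | slnil => exact le_rfl
  | cons v _ ih =>
    have := ih fun w hw => hn w (by simp [hw])
    have h1 := hn v (by simp)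
    rw [List.sum_cons, pairE_add_right]; linarith
  | cons_cons v _ ih =>
    have := ih fun w hw => hn w (by simp [hw])
    rw [List.sum_cons, List.sum_cons, pairE_add_right, pairE_add_right]; linarith

theorem DD_bdd {d : ℕ} {Λ : AddSubgroup (Vd d)} (hΛ : IsLatticeSub Λ) (T : Finset (Vd d))
    (hT : ∀ v ∈ T, v ∈ Λ) (s : Vd d) :
    ∃ R : ℝ, ∀ x, DD T.toList (chi s T) x ≠ 0 → x ∈ Metric.closedBall s R := by
  classical
  obtain ⟨Φ, _, hΦ⟩ := weyl hΛ T hT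
  set C : Vd d → ℝ := fun φ => - pairE φ T.toList.sum with hC
  have hneg : ∀ φ ∈ Φ, ∀ v ∈ T, pairE φ v ≤ 0 := by
    intro φ hφ v hv
    have := cone_gen_mem hv
    rw [hΦ] at this
    exact this.2 φ hφ
  have hC0 : ∀ φ ∈ Φ, 0 ≤ C φ := by
    intro φ hφ
    have := sublist_le φ (List.nil_sublist T.toList) fun v hv => hneg φ hφ v (by simpa using hv)
    simp only [List.sum_nil, pairE_zero_right] at this
    simp only [hC]; linarith
  set M : ℝ := ∑ φ ∈ Φ, ∑ v ∈ T, C φ / (- pairE φ v) with hM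
  refine ⟨∑ v ∈ T, M * ‖v‖, fun x hx => ?_⟩
  obtain ⟨l', hl', hF⟩ := DD_ne_zero _ _ _ hx
  have hxc : x - s ∈ cone T := by
    have h1 := chi_ne hF
    have h2 := list_sum_mem_cone (T := T) l' fun v hv => by
      simpa using hl'.subset hv
    have := cone_add_mem h1 h2
    convert this using 1; abel
  have hxs : x - s ∈ Submodule.span ℝ (Λ : Set (Vd d)) := by
    rw [hΦ] at hxc; exact hxc.1
  have key : ∀ v ∈ T, ∃ φ ∈ Φ, pairE φ v < 0 ∧ - C φ < pairE φ (x - s) := by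
    intro v hv
    by_contra hcon
    push Not at hcon
    apply hx
    refine DD_eq_zero _ _ v x (by simpa using hv) fun l₁ hl₁ => chi_congr ?_
    have hl₁T : ∀ w ∈ l₁, w ∈ T := fun w hw => by
      have := List.mem_of_mem_erase (hl₁.subset hw)
      simpa using this
    have hsp : l₁.sum ∈ Submodule.span ℝ (Λ : Set (Vd d)) := by
      have := list_sum_mem_cone l₁ hl₁T
      rw [hΦ] at this; exact this.1
    have hvsp : v ∈ Submodule.span ℝ (Λ : Set (Vd d)) := Submodule.subset_span (hT v hv)
    have e1 : x - l₁.sum - s = (x - s) - l₁.sum := by abel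
    have e2 : x - l₁.sum - v - s = (x - s) - l₁.sum - v := by abel
    rw [e1, e2, hΦ]
    constructor
    · rintro ⟨_, h2⟩
      refine ⟨Submodule.sub_mem _ (Submodule.sub_mem _ hxs hsp) hvsp, fun φ hφ => ?_⟩
      rcases (hneg φ hφ v hv).lt_or_eq with h | h
      · have a := hcon φ hφ h
        have b := sublist_le φ (hl₁.cons_cons v) fun w hw => hneg φ hφ w (by
          rcases List.mem_cons.1 hw with rfl | hw
          · exact hv
          · simpa using List.mem_of_mem_erase hw)
        have c : pairE φ (v :: T.toList.erase v).sum = pairE φ T.toList.sum := by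
          rw [(List.perm_cons_erase (by simpa using hv : v ∈ T.toList)).sum_eq]
        rw [c, List.sum_cons, pairE_add_right] at b
        rw [pairE_sub_right, pairE_sub_right]
        simp only [hC] at a
        linarith
      · rw [pairE_sub_right, h, sub_zero]; exact h2 φ hφ
    · rintro ⟨_, h2⟩
      refine ⟨Submodule.sub_mem _ hxs hsp, fun φ hφ => ?_⟩
      have := h2 φ hφ
      rw [pairE_sub_right] at this
      linarith [hneg φ hφ v hv]
  obtain ⟨t, ht, hxt⟩ := hxc
  have htM : ∀ v ∈ T, t v ≤ M := by
    intro v hv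
    obtain ⟨φ, hφ, h1, h2⟩ := key v hv
    have h3 : pairE φ (x - s) ≤ t v * pairE φ v := by
      rw [hxt, pairE_sum_right, ← Finset.add_sum_erase T _ hv, pairE_smul_right]
      have : ∑ w ∈ T.erase v, pairE φ (t w • w) ≤ 0 := Finset.sum_nonpos fun w hw => by
        have hw' := (Finset.mem_erase.1 hw).2
        rw [pairE_smul_right]
        exact mul_nonpos_of_nonneg_of_nonpos (ht w hw') (hneg φ hφ w hw')
      linarith
    have h4 : t v ≤ C φ / (- pairE φ v) := by
      rw [le_div_iff₀ (by linarith)]; nlinarith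
    have h5 : ∀ φ ∈ Φ, ∀ w ∈ T, 0 ≤ C φ / (- pairE φ w) := fun φ hφ w hw =>
      div_nonneg (hC0 φ hφ) (by linarith [hneg φ hφ w hw])
    calc t v ≤ C φ / (- pairE φ v) := h4
      _ ≤ ∑ w ∈ T, C φ / (- pairE φ w) :=
          Finset.single_le_sum (f := fun w => C φ / (- pairE φ w)) (h5 φ hφ) hv
      _ ≤ M := Finset.single_le_sum (f := fun φ => ∑ w ∈ T, C φ / (- pairE φ w))
          (fun φ hφ => Finset.sum_nonneg (h5 φ hφ)) hφ
  rw [Metric.mem_closedBall, dist_eq_norm, hxt]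
  refine (norm_sum_le _ _).trans (Finset.sum_le_sum fun v hv => ?_)
  rw [norm_smul, Real.norm_of_nonneg (ht v hv)]
  exact mul_le_mul_of_nonneg_right (htM v hv) (norm_nonneg _)

theorem DD_measurable {d : ℕ} (l : List (Vd d)) (F : Vd d → ℝ) (hF : Measurable F) :
    Measurable (DD l F) := by
  induction l with
  | nil => exact hF
  | cons v l ih => exact ih.sub (ih.comp (measurable_id.sub_const v))

theorem DD_le {d : ℕ} (l : List (Vd d)) (F : Vd d → ℝ) (hF : ∀ x, |F x| ≤ 1) :
    ∀ x, |DD l F x| ≤ 2 ^ l.length := by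
  induction l with
  | nil => simpa [DD] using hF
  | cons v l ih =>
    intro x
    simp only [DD, List.length_cons, pow_succ]
    calc _ ≤ |DD l F x| + |DD l F (x - v)| := abs_sub _ _
      _ ≤ _ := by linarith [ih x, ih (x - v)]

theorem chi_le {d : ℕ} (s : Vd d) (T : Finset (Vd d)) (x : Vd d) : |chi s T x| ≤ 1 := by
  unfold chi
  by_cases h : x ∈ (fun x => s + x) '' cone T
  · rw [Set.indicator_of_mem h]; simp
  · rw [Set.indicator_of_notMem h]; simp

theorem tr_measurable {d : ℕ} {Λ : AddSubgroup (Vd d)} (hΛ : IsLatticeSub Λ) (T : Finset (Vd d))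
    (hT : ∀ v ∈ T, v ∈ Λ) (s : Vd d) : MeasurableSet ((fun x => s + x) '' cone T) :=
  ((Homeomorph.addLeft s).isClosedMap _ (cone_isClosed hΛ T hT)).measurableSet

theorem chi_measurable {d : ℕ} {Λ : AddSubgroup (Vd d)} (hΛ : IsLatticeSub Λ) (T : Finset (Vd d))
    (hT : ∀ v ∈ T, v ∈ Λ) (s : Vd d) : Measurable (chi s T) :=
  measurable_const.indicator (tr_measurable hΛ T hT s)

theorem int_bdd {d : ℕ} {ν : Measure (Vd d)} {L : Set (Vd d)} (hν : Good ν L) (G : Vd d → ℝ)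
    (hG : Measurable G) (C R : ℝ) (s : Vd d) (hC : ∀ x, |G x| ≤ C)
    (hR : ∀ x, G x ≠ 0 → x ∈ Metric.closedBall s R) (ξ : Vd d) :
    Integrable (fun x => G x * Real.exp (pairE ξ x)) ν := by
  have hsupp : Function.support (fun x => G x * Real.exp (pairE ξ x)) ⊆ Metric.closedBall s R := by
    intro x hx
    exact hR x fun h => hx (by simp [h])
  rw [← integrableOn_iff_integrable_of_support_subset hsupp]
  have hcont : Continuous fun x => Real.exp (pairE ξ x) :=
    Real.continuous_exp.comp (continuous_pairE ξ)
  obtain ⟨K, hK⟩ := (isCompact_closedBall s R).exists_bound_of_continuousOn hcont.continuousOn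
  refine Measure.integrableOn_of_bounded (M := C * K)
    (hν.fin _ Metric.isBounded_closedBall).ne
    ((hG.mul hcont.measurable).aestronglyMeasurable) ?_
  rw [ae_restrict_iff' Metric.isClosed_closedBall.measurableSet]
  refine Eventually.of_forall fun x hx => ?_
  rw [norm_mul]
  exact mul_le_mul (hC x) (hK x hx) (norm_nonneg _) ((abs_nonneg _).trans (hC x))

theorem line_analytic_pos {d : ℕ} {ν : Measure (Vd d)} (G : Vd d → ℝ)
    (hG : Measurable G) (h0 : ∀ x, 0 ≤ G x)
    (hint : ∀ ξ : Vd d, Integrable (fun x => G x * Real.exp (pairE ξ x)) ν) (ξ₀ η : Vd d) :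
    AnalyticOnNhd ℝ (fun t : ℝ => ∫ x, G x * Real.exp (pairE (ξ₀ + t • η) x) ∂ν) Set.univ := by
  set D : Vd d → NNReal := fun x => Real.toNNReal (G x * Real.exp (pairE ξ₀ x)) with hD
  have hDm : Measurable D :=
    (hG.mul (Real.continuous_exp.comp (continuous_pairE ξ₀)).measurable).real_toNNReal
  have hDv : ∀ x, (D x : ℝ) = G x * Real.exp (pairE ξ₀ x) := fun x =>
    Real.coe_toNNReal _ (mul_nonneg (h0 x) (Real.exp_pos _).le)
  set m := ν.withDensity fun x => (D x : ℝ≥0∞) with hm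
  have e : ∀ (t : ℝ) (x : Vd d), D x • Real.exp (t * pairE η x)
      = G x * Real.exp (pairE (ξ₀ + t • η) x) := by
    intro t x
    rw [NNReal.smul_def, hDv, smul_eq_mul, mul_assoc, ← Real.exp_add, pairE_add_left,
      pairE_smul_left]
  have h1 : (fun t : ℝ => ∫ x, G x * Real.exp (pairE (ξ₀ + t • η) x) ∂ν)
      = ProbabilityTheory.mgf (fun x => pairE η x) m := by
    ext t
    rw [ProbabilityTheory.mgf, hm, integral_withDensity_eq_integral_smul hDm]
    simp_rw [e]
  have h2 : ProbabilityTheory.integrableExpSet (fun x => pairE η x) m = Set.univ := by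
    ext t
    simp only [ProbabilityTheory.integrableExpSet, Set.mem_univ, iff_true]
    show Integrable _ _
    rw [hm, integrable_withDensity_iff_integrable_smul hDm]
    simp_rw [e]
    exact hint _
  rw [h1]
  have := ProbabilityTheory.analyticOnNhd_mgf (X := fun x => pairE η x) (μ := m)
  rwa [h2, interior_univ] at this

theorem line_analytic {d : ℕ} {ν : Measure (Vd d)} {L : Set (Vd d)} (hν : Good ν L) (G : Vd d → ℝ)
    (hG : Measurable G) (C R : ℝ) (s : Vd d) (hC : ∀ x, |G x| ≤ C)
    (hR : ∀ x, G x ≠ 0 → x ∈ Metric.closedBall s R) (ξ₀ η : Vd d) :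
    AnalyticOnNhd ℝ (fun t : ℝ => ∫ x, G x * Real.exp (pairE (ξ₀ + t • η) x) ∂ν) Set.univ := by
  have hp : ∀ ξ : Vd d, Integrable (fun x => max (G x) 0 * Real.exp (pairE ξ x)) ν := by
    refine int_bdd hν _ (hG.max measurable_const) C R s (fun x => ?_) fun x hx => hR x ?_
    · rw [abs_of_nonneg (le_max_right _ _)]
      exact max_le ((le_abs_self _).trans (hC x)) ((abs_nonneg _).trans (hC x))
    · intro h; apply hx; simp [h]
  have hn : ∀ ξ : Vd d, Integrable (fun x => max (-G x) 0 * Real.exp (pairE ξ x)) ν := by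
    refine int_bdd hν _ (hG.neg.max measurable_const) C R s (fun x => ?_) fun x hx => hR x ?_
    · rw [abs_of_nonneg (le_max_right _ _)]
      exact max_le ((neg_le_abs _).trans (hC x)) ((abs_nonneg _).trans (hC x))
    · intro h; apply hx; simp [h]
  have h1 := line_analytic_pos _ (hG.max measurable_const) (fun x => le_max_right _ _) hp ξ₀ η
  have h2 := line_analytic_pos _ (hG.neg.max measurable_const) (fun x => le_max_right _ _) hn ξ₀ η
  convert h1.sub h2 using 1
  ext t
  simp only [Pi.sub_apply, Pi.neg_apply]
  rw [← integral_sub (hp _) (hn _)]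
  congr 1; ext x
  rw [← sub_mul]
  congr 1
  rcases le_total 0 (G x) with h | h
  · rw [max_eq_left h, max_eq_right (by linarith)]; ring
  · rw [max_eq_right h, max_eq_left (by linarith)]; ring

open MeasureTheory Filter Topology Set
open scoped RealInnerProductSpace Pointwise BigOperators ENNReal

/-! ### Convergence of the integrals -/

theorem lint_step {d : ℕ} {ν : Measure (Vd d)} {L : Set (Vd d)} (hν : Good ν L) {v ξ : Vd d}
    (hv : v ∈ L) (hξ : pairE ξ v < 0) (A : Set (Vd d))
    (hA : ∫⁻ x in A, ENNReal.ofReal (Real.exp (pairE ξ x)) ∂ν < ⊤) :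
    ∫⁻ x in {x | ∃ n : ℕ, x - n • v ∈ A}, ENNReal.ofReal (Real.exp (pairE ξ x)) ∂ν < ⊤ := by
  set E : Vd d → ℝ≥0∞ := fun x => ENNReal.ofReal (Real.exp (pairE ξ x)) with hE
  set q : ℝ≥0∞ := ENNReal.ofReal (Real.exp (pairE ξ v)) with hq
  have hq1 : q < 1 := by
    rw [hq, ← ENNReal.ofReal_one, ENNReal.ofReal_lt_ofReal_iff one_pos]
    simpa using hξ
  have hqE : ∀ x, E x = q * E (x - v) := by
    intro x
    rw [hE, hq]; simp only
    rw [← ENNReal.ofReal_mul (Real.exp_pos _).le, ← Real.exp_add, pairE_sub_right]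
    congr 2; ring
  have hstep : ∀ B : Set (Vd d), ∫⁻ x in (fun x => x - v) ⁻¹' B, E x ∂ν = q * ∫⁻ x in B, E x ∂ν := by
    intro B
    have := (hν.inv v hv).setLIntegral_comp_preimage_emb (measurableEmbedding_sub v) E B
    rw [← this, ← lintegral_const_mul' _ _ hq1.ne_top]
    exact lintegral_congr fun x => hqE x
  have hn : ∀ n : ℕ, ∫⁻ x in {x | x - n • v ∈ A}, E x ∂ν = q ^ n * ∫⁻ x in A, E x ∂ν := by
    intro n
    induction n with
    | zero => simp
    | succ n ih =>
      have : {x : Vd d | x - (n + 1) • v ∈ A} = (fun x => x - v) ⁻¹' {x | x - n • v ∈ A} := by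
        ext x
        show x - (n+1) • v ∈ A ↔ x - v - n • v ∈ A
        rw [add_smul, one_smul]
        have : x - (n • v + v) = x - v - n • v := by abel
        rw [this]
      rw [this, hstep, ih, pow_succ]; ring
  have hU : {x : Vd d | ∃ n : ℕ, x - n • v ∈ A} = ⋃ n : ℕ, {x | x - n • v ∈ A} := by
    ext x; simp
  rw [hU]
  refine (lintegral_iUnion_le _ _).trans_lt ?_
  rw [tsum_congr hn]
  rw [ENNReal.tsum_mul_right, ENNReal.tsum_geometric]
  refine ENNReal.mul_lt_top ?_ hA
  rw [lt_top_iff_ne_top, Ne, ENNReal.inv_eq_top, tsub_eq_zero_iff_le]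
  exact not_le.2 hq1

theorem lint_box {d : ℕ} {ν : Measure (Vd d)} {L : Set (Vd d)} (hν : Good ν L) {ξ : Vd d}
    (T : Finset (Vd d)) (hT : ∀ v ∈ T, v ∈ L) (hξ : ∀ v ∈ T, pairE ξ v < 0) (A : Set (Vd d))
    (hA : ∫⁻ x in A, ENNReal.ofReal (Real.exp (pairE ξ x)) ∂ν < ⊤) :
    ∫⁻ x in {x | ∃ n : Vd d → ℕ, x - ∑ v ∈ T, n v • v ∈ A},
      ENNReal.ofReal (Real.exp (pairE ξ x)) ∂ν < ⊤ := by
  classical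
  induction T using Finset.induction_on with
  | empty => simpa using hA
  | insert a T ha ih =>
    have h1 := ih (fun v hv => hT v (by simp [hv])) (fun v hv => hξ v (by simp [hv]))
    have h2 := lint_step hν (hT a (by simp)) (hξ a (by simp)) _ h1
    refine (lintegral_mono_set ?_).trans_lt h2
    rintro x ⟨n, hn⟩
    refine ⟨n a, n, ?_⟩
    rw [Finset.sum_insert ha] at hn
    rwa [sub_sub]

theorem int_cone {d : ℕ} {ν : Measure (Vd d)} {L : Set (Vd d)} (hν : Good ν L) {ξ : Vd d}
    (T : Finset (Vd d)) (hT : ∀ v ∈ T, v ∈ L) (hξ : ∀ v ∈ T, pairE ξ v < 0) (s : Vd d) :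
    IntegrableOn (fun x => Real.exp (pairE ξ x)) ((fun x => s + x) '' cone T) ν := by
  have hcont : Continuous fun x => Real.exp (pairE ξ x) :=
    Real.continuous_exp.comp (continuous_pairE ξ)
  refine ⟨hcont.aestronglyMeasurable, ?_⟩
  rw [hasFiniteIntegral_iff_ofReal (Eventually.of_forall fun x => (Real.exp_pos _).le)]
  have hA : ∫⁻ x in Metric.closedBall s (∑ v ∈ T, ‖v‖),
      ENNReal.ofReal (Real.exp (pairE ξ x)) ∂ν < ⊤ := by
    obtain ⟨K, hK⟩ := (isCompact_closedBall s (∑ v ∈ T, ‖v‖)).exists_bound_of_continuousOn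
      hcont.continuousOn
    refine (setLIntegral_mono' (g := fun _ => ENNReal.ofReal K)
      Metric.isClosed_closedBall.measurableSet fun x hx => ?_).trans_lt ?_
    · exact ENNReal.ofReal_le_ofReal ((le_abs_self _).trans (hK x hx))
    · rw [setLIntegral_const]
      exact ENNReal.mul_lt_top ENNReal.ofReal_lt_top (hν.fin _ Metric.isBounded_closedBall)
  refine (lintegral_mono_set ?_).trans_lt (lint_box hν T hT hξ _ hA)
  rintro x hx
  rw [mem_tr] at hx
  obtain ⟨t, ht, hxt⟩ := hx
  refine ⟨fun v => ⌊t v⌋₊, ?_⟩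
  rw [Metric.mem_closedBall, dist_eq_norm]
  have : x - ∑ v ∈ T, ⌊t v⌋₊ • v - s = ∑ v ∈ T, (t v - ⌊t v⌋₊) • v := by
    rw [sub_right_comm, hxt, ← Finset.sum_sub_distrib]
    refine Finset.sum_congr rfl fun v _ => ?_
    rw [sub_smul, Nat.cast_smul_eq_nsmul]
  rw [this]
  refine (norm_sum_le _ _).trans (Finset.sum_le_sum fun v hv => ?_)
  rw [norm_smul, Real.norm_of_nonneg (by linarith [Nat.floor_le (ht v hv)])]
  exact mul_le_of_le_one_left (norm_nonneg _) (by linarith [Nat.lt_floor_add_one (t v)])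

theorem chi_int {d : ℕ} {Λ : AddSubgroup (Vd d)} (hΛ : IsLatticeSub Λ) {ν : Measure (Vd d)}
    (T : Finset (Vd d)) (hT : ∀ v ∈ T, v ∈ Λ) (s ξ : Vd d)
    (h : IntegrableOn (fun x => Real.exp (pairE ξ x)) ((fun x => s + x) '' cone T) ν) :
    Integrable (fun x => chi s T x * Real.exp (pairE ξ x)) ν ∧
    ∫ x, chi s T x * Real.exp (pairE ξ x) ∂ν
      = ∫ x in (fun x => s + x) '' cone T, Real.exp (pairE ξ x) ∂ν := by
  have e : (fun x => chi s T x * Real.exp (pairE ξ x))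
      = Set.indicator ((fun x => s + x) '' cone T) (fun x => Real.exp (pairE ξ x)) := by
    ext x
    unfold chi
    by_cases hx : x ∈ (fun x => s + x) '' cone T
    · rw [Set.indicator_of_mem hx, Set.indicator_of_mem hx, one_mul]
    · rw [Set.indicator_of_notMem hx, Set.indicator_of_notMem hx, zero_mul]
  rw [e]
  exact ⟨(integrable_indicator_iff (tr_measurable hΛ T hT s)).2 h,
    integral_indicator (tr_measurable hΛ T hT s)⟩

theorem HasRatSeriesAt0.analyticAt {d : ℕ} {Λ : AddSubgroup (Vd d)} {g : Vd d → ℝ}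
    (h : HasRatSeriesAt0 Λ g) : AnalyticAt ℝ g 0 := by
  obtain ⟨p, hp, _⟩ := h
  exact hp.analyticAt

theorem ev_analytic {d : ℕ} (l : List (Vd d)) (ξ : Vd d) : AnalyticAt ℝ (ev l) ξ := by
  induction l with
  | nil =>
    have : (ev ([] : List (Vd d))) = fun _ => 1 := by ext; simp [ev]
    rw [this]; exact analyticAt_const
  | cons v l ih =>
    have : ev (v :: l) = fun ξ => (1 - Real.exp (innerSL ℝ v ξ)) * ev l ξ := by
      ext ξ; simp [ev, pairE, real_inner_comm]
    rw [this]
    exact (analyticAt_const.sub ((innerSL ℝ v).analyticAt ξ).rexp').mul ih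

theorem mero_key {d : ℕ} {Λ : AddSubgroup (Vd d)} (hΛ : IsLatticeSub Λ) {ν : Measure (Vd d)}
    {L : Set (Vd d)} (hν : Good ν L) (T : Finset (Vd d)) (hTL : ∀ v ∈ T, v ∈ L)
    (hT : ∀ v ∈ T, v ≠ 0 ∧ v ∈ Λ) (s : Vd d) (f : Vd d → ℝ) (hf : RatMeromorphicAt0 Λ f)
    (hline : ContainsLine ((fun x => s + x) '' cone T) → ∀ ξ, f ξ = 0)
    (hint : ∀ ξ, IntegrableOn (fun x => Real.exp (pairE ξ x)) ((fun x => s + x) '' cone T) ν →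
      f ξ = ∫ x in (fun x => s + x) '' cone T, Real.exp (pairE ξ x) ∂ν) :
    Gen fun ξ => Integrable (fun x => DD T.toList (chi s T) x * Real.exp (pairE ξ x)) ν ∧
      f ξ * ev T.toList ξ = ∫ x, DD T.toList (chi s T) x * Real.exp (pairE ξ x) ∂ν ∧
      ev T.toList ξ ≠ 0 := by
  have hev : Gen fun ξ => ev T.toList ξ ≠ 0 :=
    (Gen.finset T fun v hv => Gen.pair_ne (hT v hv).1).mono fun ξ h =>
      ev_ne_zero _ _ fun v hv => h v (by simpa using hv)
  rcases gordan T with ⟨v, hv, hv'⟩ | ⟨η, hη⟩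
  · refine hev.mono fun ξ h => ?_
    have h0 : (fun x => DD T.toList (chi s T) x * Real.exp (pairE ξ x)) = fun _ => 0 := by
      ext x; rw [DD_line T s hv hv', zero_mul]
    rw [h0, hline (containsLine_of T s (hT v hv).1 (cone_gen_mem hv) hv') ξ]
    exact ⟨integrable_zero _ _ _, by simp, h⟩
  · obtain ⟨g, h, hg, hh, hne, hfgh⟩ := hf
    have hga := hg.analyticAt
    have hha := hh.analyticAt
    set G := DD T.toList (chi s T) with hG
    have hTΛ : ∀ v ∈ T, v ∈ Λ := fun v hv => (hT v hv).2
    have hGm : Measurable G := DD_measurable _ _ (chi_measurable hΛ T hTΛ s)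
    have hGb : ∀ x, |G x| ≤ 2 ^ T.toList.length := DD_le _ _ (chi_le s T)
    obtain ⟨R, hR⟩ := DD_bdd hΛ T hTΛ s
    have hGi : ∀ ξ, Integrable (fun x => G x * Real.exp (pairE ξ x)) ν :=
      int_bdd hν G hGm _ R s hGb hR
    set J : Vd d → ℝ := fun ξ => ∫ x, G x * Real.exp (pairE ξ x) ∂ν with hJ
    -- the identity on the convergence domain
    have hU : ∀ ξ, (∀ v ∈ T, pairE ξ v < 0) → f ξ * ev T.toList ξ = J ξ := by
      intro ξ hξ
      have h1 := int_cone hν T hTL hξ s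
      have h2 := chi_int hΛ T hTΛ s ξ h1
      have h3 := (DD_int hν T.toList (fun v hv => hTL v (by simpa using hv)) _ ξ h2.1).2
      simp only [hJ, hG]
      rw [h3, h2.2, hint ξ h1]; ring
    -- a good ball
    obtain ⟨r, hr, hball⟩ := Metric.eventually_nhds_iff_ball.1
      ((hga.eventually_analyticAt.and hha.eventually_analyticAt).and hfgh)
    set U : Set (Vd d) := {ξ | ∀ v ∈ T, pairE ξ v < 0} with hUdef
    have hUo : IsOpen U := by
      have : U = ⋂ v ∈ T, {ξ | pairE ξ v < 0} := by ext; simp [hUdef]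
      rw [this]
      exact isOpen_biInter_finset fun v _ => isOpen_lt (continuous_pairE_left v) continuous_const
    have hnear : ∀ ξ ∈ Metric.ball (0 : Vd d) r, ξ ∈ U → g ξ * ev T.toList ξ = h ξ * J ξ ∨ h ξ = 0 := by
      intro ξ hξ hξU
      by_cases h0 : h ξ = 0
      · exact Or.inr h0
      · left
        have h1 := (hball ξ hξ).2 h0
        rw [← h1, ← hU ξ hξU]; ring
    -- a point of convergence where h does not vanish
    obtain ⟨ξ₀, hξ₀b, hξ₀U, hξ₀⟩ : ∃ ξ₀ ∈ Metric.ball (0 : Vd d) r, ξ₀ ∈ U ∧ h ξ₀ ≠ 0 := by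
      obtain ⟨Z, hZ, hZi, hZe⟩ := Gen.analytic_ne hha hne
      obtain ⟨r', hr', hball'⟩ := Metric.eventually_nhds_iff_ball.1 hZe
      have htend : Tendsto (fun t : ℝ => t • η) (𝓝[>] 0) (𝓝 0) := by
        have : Tendsto (fun t : ℝ => t • η) (𝓝 0) (𝓝 ((0:ℝ) • η)) :=
          (continuous_id.smul continuous_const).tendsto 0
        rw [zero_smul] at this
        exact this.mono_left nhdsWithin_le_nhds
      obtain ⟨t, ht1, ht0⟩ := ((htend.eventually
        (Metric.ball_mem_nhds (0 : Vd d) (lt_min hr hr'))).and self_mem_nhdsWithin).exists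
      have hopen : IsOpen (Metric.ball (0 : Vd d) (min r r') ∩ U) := Metric.isOpen_ball.inter hUo
      have hmem : t • η ∈ Metric.ball (0 : Vd d) (min r r') ∩ U := by
        refine ⟨ht1, fun v hv => ?_⟩
        rw [pairE_smul_left]
        exact mul_neg_of_pos_of_neg ht0 (hη v hv)
      have : ¬ (Metric.ball (0 : Vd d) (min r r') ∩ U ⊆ Z) := by
        intro hsub
        have := interior_maximal hsub hopen hmem
        rw [hZi] at this; exact this
      obtain ⟨ξ₀, ⟨hb, hu⟩, hz⟩ := Set.not_subset.1 this
      exact ⟨ξ₀, Metric.ball_subset_ball (min_le_left _ _) hb, hu,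
        hball' ξ₀ (Metric.ball_subset_ball (min_le_right _ _) hb) hz⟩
    -- analytic continuation along lines
    have hmain : ∀ ξ ∈ Metric.ball (0 : Vd d) r, g ξ * ev T.toList ξ = h ξ * J ξ := by
      intro ξ hξ
      set p : ℝ → Vd d := fun t => ξ₀ + t • (ξ - ξ₀) with hp
      have hpc : Continuous p := by fun_prop
      have hpa : ∀ t, AnalyticAt ℝ p t := by
        intro t
        exact analyticAt_const.add (analyticAt_id.smul analyticAt_const)
      set W : Set ℝ := p ⁻¹' Metric.ball 0 r with hW
      have hWc : IsPreconnected W := by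
        apply Convex.isPreconnected
        intro x hx y hy a b ha hb hab
        have hx' : p x ∈ Metric.ball (0 : Vd d) r := hx
        have hy' : p y ∈ Metric.ball (0 : Vd d) r := hy
        have := (convex_ball (0 : Vd d) r) hx' hy' ha hb hab
        show p (a • x + b • y) ∈ Metric.ball (0 : Vd d) r
        convert this using 1
        simp only [hp, smul_eq_mul]
        have hb' : b = 1 - a := by linarith
        subst hb'
        module
      have h1 : AnalyticOnNhd ℝ (fun t => g (p t) * ev T.toList (p t)) W := fun t ht =>
        ((hball (p t) ht).1.1.comp (hpa t)).mul ((ev_analytic _ (p t)).comp (hpa t))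
      have h2 : AnalyticOnNhd ℝ (fun t => h (p t) * J (p t)) W := fun t ht =>
        ((hball (p t) ht).1.2.comp (hpa t)).mul
          (line_analytic hν G hGm _ R s hGb hR ξ₀ (ξ - ξ₀) t (Set.mem_univ t))
      have hp0 : p 0 = ξ₀ := by simp [hp]
      have hp1 : p 1 = ξ := by simp [hp]
      have h0W : (0 : ℝ) ∈ W := by show p 0 ∈ Metric.ball (0 : Vd d) r; rw [hp0]; exact hξ₀b
      have h1W : (1 : ℝ) ∈ W := by show p 1 ∈ Metric.ball (0 : Vd d) r; rw [hp1]; exact hξ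
      have hev0 : (fun t => g (p t) * ev T.toList (p t)) =ᶠ[𝓝 0] fun t => h (p t) * J (p t) := by
        have c1 : ∀ᶠ t in 𝓝 (0:ℝ), p t ∈ Metric.ball (0 : Vd d) r :=
          hpc.continuousAt.eventually_mem (by rw [hp0]; exact Metric.isOpen_ball.mem_nhds hξ₀b)
        have c2 : ∀ᶠ t in 𝓝 (0:ℝ), p t ∈ U :=
          hpc.continuousAt.eventually_mem (by rw [hp0]; exact hUo.mem_nhds hξ₀U)
        have c3 : ∀ᶠ t in 𝓝 (0:ℝ), h (p t) ≠ 0 := by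
          have : ContinuousAt (fun t => h (p t)) 0 :=
            ((hball (p 0) h0W).1.2.comp (hpa 0)).continuousAt
          exact this.eventually_ne (by rw [hp0]; exact hξ₀)
        filter_upwards [c1, c2, c3] with t a b c
        exact (hnear _ a b).resolve_right c
      have := h1.eqOn_of_preconnected_of_eventuallyEq h2 hWc h0W hev0 h1W
      simpa only [hp1] using this
    have hb : Gen fun ξ => ξ ∈ Metric.ball (0 : Vd d) r :=
      ⟨∅, isClosed_empty, interior_empty,
        Eventually.mono (Metric.ball_mem_nhds (0 : Vd d) hr) fun ξ a _ => a⟩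
    refine ((hev.and (Gen.analytic_ne hha hne)).and hb).mono ?_
    rintro ξ ⟨⟨a, b⟩, c⟩
    refine ⟨hGi ξ, ?_, a⟩
    have h1 := (hball ξ c).2 b
    have h2 := hmain ξ c
    apply mul_left_cancel₀ b
    rw [← h1] at h2
    show h ξ * (f ξ * ev T.toList ξ) = h ξ * J ξ
    linarith

open MeasureTheory Filter Topology Set
open scoped RealInnerProductSpace Pointwise BigOperators ENNReal

/-! ### Lattices -/

theorem lat_of_finrank {d : ℕ} (N : Submodule ℤ (Vd d)) [Module.Finite ℤ N]
    (h : Module.finrank ℤ N ≤ Module.finrank ℝ (Submodule.span ℝ (N : Set (Vd d)))) :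
    IsLatticeSub N.toAddSubgroup := by
  have htf : IsAddTorsionFree (Vd d) := by
    refine ⟨fun n hn x y h => ?_⟩
    have h1 : (n : ℝ) • x = (n : ℝ) • y := by
      simpa [Nat.cast_smul_eq_nsmul] using h
    exact smul_right_injective _ (Nat.cast_ne_zero.2 hn) h1
  have : Module.Free ℤ N := inferInstance
  let b := Module.finBasis ℤ N
  set v : Fin (Module.finrank ℤ N) → Vd d := fun i => (b i : Vd d) with hv
  have hspan : Submodule.span ℤ (Set.range v) = N := by
    have : Set.range v = N.subtype '' Set.range b := by
      rw [← Set.range_comp]; rfl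
    rw [this, ← Submodule.map_span, b.span_eq, Submodule.map_top, Submodule.range_subtype]
  have hspanR : Submodule.span ℝ (Set.range v) = Submodule.span ℝ (N : Set (Vd d)) := by
    rw [← Submodule.span_span_of_tower ℤ ℝ (Set.range v), hspan]
  refine ⟨_, v, ?_, ?_⟩
  · rw [linearIndependent_iff_card_eq_finrank_span]
    apply le_antisymm
    · rw [Set.finrank, hspanR]; simpa using h
    · exact finrank_range_le_card v
  · rw [← Submodule.span_int_eq_addSubgroupClosure, hspan]

theorem lat_ext {d : ℕ} {Λ : AddSubgroup (Vd d)} (hΛ : IsLatticeSub Λ) :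
    ∃ (ι : Type) (_ : Fintype ι) (b : Module.Basis ι ℝ (Vd d)),
      (Λ : Set (Vd d)) ⊆ Submodule.span ℤ (Set.range b) := by
  classical
  obtain ⟨k, v, hv, rfl⟩ := hΛ
  let b := Module.Basis.extend hv.linearIndepOn_id
  have := FiniteDimensional.fintypeBasisIndex b
  refine ⟨_, this, b, ?_⟩
  rw [← Submodule.span_int_eq_addSubgroupClosure]
  show (Submodule.span ℤ (Set.range v) : Set (Vd d)) ⊆ _
  refine Submodule.span_mono ?_
  rw [Module.Basis.range_extend]
  exact Module.Basis.subset_extend _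

theorem lat_finite {d : ℕ} {Λ : AddSubgroup (Vd d)} (hΛ : IsLatticeSub Λ) {B : Set (Vd d)}
    (hB : Bornology.IsBounded B) : (B ∩ (Λ : Set (Vd d))).Finite := by
  obtain ⟨ι, _, b, hb⟩ := lat_ext hΛ
  exact (ZSpan.setFinite_inter b hB).subset (Set.inter_subset_inter_right _ hb)

theorem lat_countable {d : ℕ} {Λ : AddSubgroup (Vd d)} (hΛ : IsLatticeSub Λ) :
    (Λ : Set (Vd d)).Countable := by
  have : (Λ : Set (Vd d)) = ⋃ n : ℕ, Metric.ball (0 : Vd d) n ∩ (Λ : Set (Vd d)) := by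
    rw [← Set.iUnion_inter, Metric.iUnion_ball_nat, Set.univ_inter]
  rw [this]
  exact Set.countable_iUnion fun n => (lat_finite hΛ Metric.isBounded_ball).countable

theorem lat_module_finite {d : ℕ} {Λ : AddSubgroup (Vd d)} (hΛ : IsLatticeSub Λ) :
    Module.Finite ℤ (AddSubgroup.toIntSubmodule Λ) := by
  obtain ⟨k, v, hv, rfl⟩ := hΛ
  rw [← Submodule.span_int_eq_addSubgroupClosure, Submodule.toAddSubgroup_toIntSubmodule]
  exact Module.Finite.span_of_finite ℤ (Set.finite_range v)

theorem lat_finrank {d : ℕ} {Λ : AddSubgroup (Vd d)} (hΛ : IsLatticeSub Λ) (N : Submodule ℤ (Vd d))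
    (hN : N ≤ AddSubgroup.toIntSubmodule Λ) :
    Module.finrank ℝ (Submodule.span ℝ (N : Set (Vd d))) = Module.finrank ℤ N := by
  obtain ⟨ι, _, b, hb⟩ := lat_ext hΛ
  have h1 : DiscreteTopology (Submodule.span ℤ (N : Set (Vd d))) := by
    rw [Submodule.span_eq]
    have h0 : DiscreteTopology (Submodule.span ℤ (Set.range b)) := inferInstance
    exact DiscreteTopology.of_subset (s := (Submodule.span ℤ (Set.range b) : Set (Vd d)))
      h0 (fun x hx => hb (hN hx))
  have := Real.finrank_eq_int_finrank_of_discrete h1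
  rw [Set.finrank, Set.finrank, Submodule.span_eq] at this
  exact this

theorem lat_sub_finite {d : ℕ} {Λ : AddSubgroup (Vd d)} (hΛ : IsLatticeSub Λ) (N : Submodule ℤ (Vd d))
    (hN : N ≤ AddSubgroup.toIntSubmodule Λ) : Module.Finite ℤ N := by
  have := lat_module_finite hΛ
  exact Module.Finite.of_injective (Submodule.inclusion hN) (Submodule.inclusion_injective hN)

/-- a subgroup of a lattice is a lattice -/
theorem lat_sub {d : ℕ} {Λ M : AddSubgroup (Vd d)} (hΛ : IsLatticeSub Λ) (hM : M ≤ Λ) :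
    IsLatticeSub M := by
  have hN : AddSubgroup.toIntSubmodule M ≤ AddSubgroup.toIntSubmodule Λ := hM
  have := lat_sub_finite hΛ _ hN
  exact lat_of_finrank (AddSubgroup.toIntSubmodule M) (lat_finrank hΛ _ hN).ge

/-- the image of a lattice along the span of a sublattice is a lattice -/
theorem lat_map {d : ℕ} {Λ : AddSubgroup (Vd d)} (hΛ : IsLatticeSub Λ) (L : Submodule ℝ (Vd d))
    (hL : Submodule.span ℝ ((L : Set (Vd d)) ∩ (Λ : Set (Vd d))) = L) (π : Vd d →ₗ[ℝ] Vd d)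
    (hπ : ∀ x, π x = 0 ↔ x ∈ L) :
    IsLatticeSub (AddSubgroup.map π.toAddMonoidHom Λ) ∧
    Module.finrank ℝ (Submodule.span ℝ (AddSubgroup.map π.toAddMonoidHom Λ : Set (Vd d)))
      + Module.finrank ℝ L = Module.finrank ℝ (Submodule.span ℝ (Λ : Set (Vd d))) := by
  have hker : LinearMap.ker π = L := by ext x; simp [hπ]
  -- real dimensions
  have hLs : L ≤ Submodule.span ℝ (Λ : Set (Vd d)) := by
    rw [← hL]; exact Submodule.span_mono Set.inter_subset_right
  have hspan : Submodule.span ℝ (AddSubgroup.map π.toAddMonoidHom Λ : Set (Vd d))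
      = (Submodule.span ℝ (Λ : Set (Vd d))).map π := by
    rw [Submodule.map_span]; rfl
  have hdim : Module.finrank ℝ ((Submodule.span ℝ (Λ : Set (Vd d))).map π) + Module.finrank ℝ L
      = Module.finrank ℝ (Submodule.span ℝ (Λ : Set (Vd d))) := by
    have h1 := LinearMap.finrank_range_add_finrank_ker
      (π.domRestrict (Submodule.span ℝ (Λ : Set (Vd d))))
    rw [LinearMap.range_domRestrict] at h1
    have h2 : Module.finrank ℝ (LinearMap.ker (π.domRestrict (Submodule.span ℝ (Λ : Set (Vd d)))))
        = Module.finrank ℝ L := by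
      rw [LinearMap.ker_domRestrict, hker]
      exact (Submodule.comapSubtypeEquivOfLe hLs).finrank_eq
    rw [h2] at h1; exact h1
  refine ⟨?_, by rw [hspan]; exact hdim⟩
  -- integral ranks
  set N := AddSubgroup.toIntSubmodule Λ with hN
  have hfin : Module.Finite ℤ N := lat_module_finite hΛ
  let πZ : N →ₗ[ℤ] Vd d := (π.restrictScalars ℤ).domRestrict N
  have hrange : LinearMap.range πZ = N.map (π.restrictScalars ℤ) := LinearMap.range_domRestrict _ _
  have e : AddSubgroup.map π.toAddMonoidHom Λ = (N.map (π.restrictScalars ℤ)).toAddSubgroup := rfl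
  rw [e]
  have hfin2 : Module.Finite ℤ (N.map (π.restrictScalars ℤ)) := inferInstance
  apply lat_of_finrank
  have hz : Module.finrank ℤ (LinearMap.range πZ) + Module.finrank ℤ (LinearMap.ker πZ)
      = Module.finrank ℤ N := by
    rw [← πZ.quotKerEquivRange.finrank_eq]
    exact Submodule.finrank_quotient_add_finrank _
  have hkerfin : Module.finrank ℤ (LinearMap.ker πZ) = Module.finrank ℝ L := by
    set K : Submodule ℤ (Vd d) := (LinearMap.ker πZ).map N.subtype with hK
    have h1 : Module.finrank ℤ K = Module.finrank ℤ (LinearMap.ker πZ) :=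
      (Submodule.equivMapOfInjective N.subtype N.injective_subtype _).finrank_eq.symm
    have h2 : (K : Set (Vd d)) = (L : Set (Vd d)) ∩ (Λ : Set (Vd d)) := by
      ext x
      constructor
      · rintro ⟨y, hy, rfl⟩
        refine ⟨(hπ _).1 ?_, y.2⟩
        exact hy
      · rintro ⟨h1, h2⟩
        exact ⟨⟨x, h2⟩, (hπ x).2 h1, rfl⟩
    have h3 : K ≤ N := by
      intro x hx
      have : x ∈ (K : Set (Vd d)) := hx
      rw [h2] at this; exact this.2
    rw [← h1, ← lat_finrank hΛ K h3, h2, hL]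
  have hNr := lat_finrank hΛ N le_rfl
  have hNs : Submodule.span ℝ (N : Set (Vd d)) = Submodule.span ℝ (Λ : Set (Vd d)) := rfl
  rw [hNs] at hNr
  have h5 : Submodule.span ℝ ((N.map (π.restrictScalars ℤ) : Submodule ℤ (Vd d)) : Set (Vd d))
      = (Submodule.span ℝ (Λ : Set (Vd d))).map π := hspan
  rw [h5]
  rw [hrange] at hz
  omega

/-- an integral basis of a rational subspace -/
theorem lat_basis {d : ℕ} {Λ : AddSubgroup (Vd d)} (hΛ : IsLatticeSub Λ) (L : Submodule ℝ (Vd d))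
    (hL : Submodule.span ℝ ((L : Set (Vd d)) ∩ (Λ : Set (Vd d))) = L) :
    ∃ (k : ℕ) (v : Fin k → Vd d), (∀ i, v i ∈ Λ) ∧ LinearIndependent ℝ v ∧
      Submodule.span ℝ (Set.range v) = L ∧
      ∀ y ∈ Λ, y ∈ L → ∃ c : Fin k → ℤ, y = ∑ i, (c i : ℝ) • v i := by
  obtain ⟨k, v, hv, h⟩ := lat_sub hΛ (M := Λ ⊓ L.toAddSubgroup) inf_le_left
  have hmem : ∀ y, y ∈ Λ ⊓ L.toAddSubgroup ↔ y ∈ Submodule.span ℤ (Set.range v) := by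
    intro y
    rw [h, ← Submodule.span_int_eq_addSubgroupClosure]; rfl
  refine ⟨k, v, fun i => ?_, hv, ?_, ?_⟩
  · exact ((hmem _).2 (Submodule.subset_span ⟨i, rfl⟩)).1
  · rw [← Submodule.span_span_of_tower ℤ ℝ (Set.range v), ← hL]
    congr 1
    ext y
    have := hmem y
    constructor
    · intro hy
      exact ⟨(this.2 hy).2, (this.2 hy).1⟩
    · intro hy
      exact this.1 ⟨hy.2, hy.1⟩
  · intro y h1 h2
    obtain ⟨c, hc⟩ := (Submodule.mem_span_range_iff_exists_fun ℤ).1 ((hmem y).1 ⟨h1, h2⟩)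
    refine ⟨c, ?_⟩
    rw [← hc]
    simp only [Int.cast_smul_eq_zsmul]

/-! ### The counting measure -/

noncomputable def cnt {d : ℕ} (Λ : AddSubgroup (Vd d)) : Measure (Vd d) :=
  Measure.count.restrict (Λ : Set (Vd d))

theorem cnt_good {d : ℕ} {Λ : AddSubgroup (Vd d)} (hΛ : IsLatticeSub Λ) :
    Good (cnt Λ) (Λ : Set (Vd d)) := by
  have hm : MeasurableSet (Λ : Set (Vd d)) := (lat_countable hΛ).measurableSet
  constructor
  · intro B hB
    rw [cnt, Measure.restrict_apply' hm]
    exact Measure.count_apply_lt_top.2 (lat_finite hΛ hB)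
  · intro v hv
    have h1 : MeasurePreserving (fun x : Vd d => x - v) Measure.count Measure.count :=
      measurePreserving_sub_right _ v
    have h2 := h1.restrict_preimage hm
    have h3 : (fun x : Vd d => x - v) ⁻¹' (Λ : Set (Vd d)) = Λ := by
      ext x
      exact ⟨fun h => by simpa using Λ.add_mem h hv, fun h => Λ.sub_mem h hv⟩
    rw [h3] at h2
    exact h2

theorem cnt_sum {d : ℕ} {Λ : AddSubgroup (Vd d)} (hΛ : IsLatticeSub Λ) (P : Set (Vd d))
    (hP : MeasurableSet P) (f : Vd d → ℝ) (hf : IntegrableOn f P (cnt Λ)) :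
    Summable (fun x : ↥(P ∩ (Λ : Set (Vd d))) => f x) ∧
      ∫ x in P, f x ∂(cnt Λ) = ∑' x : ↥(P ∩ (Λ : Set (Vd d))), f x := by
  have hm : (P ∩ (Λ : Set (Vd d))).Countable := (lat_countable hΛ).mono Set.inter_subset_right
  have hmm := hm.measurableSet
  rw [IntegrableOn, cnt, Measure.restrict_restrict hP] at hf
  rw [cnt, Measure.restrict_restrict hP]
  constructor
  · have h1 := (integrable_indicator_iff hmm).2 hf
    have h2 := integrable_count_iff.1 h1
    exact summable_subtype_iff_indicator.2 h2.of_norm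
  · rw [setIntegral_countable _ hm hf]
    simp [measureReal_def]

open MeasureTheory Filter Topology Set
open scoped RealInnerProductSpace Pointwise BigOperators ENNReal

/-! ### The canonical Lebesgue measure -/

theorem canon {d : ℕ} {Λ : AddSubgroup (Vd d)} (hΛ : IsLatticeSub Λ) (L : Submodule ℝ (Vd d))
    (hL : Submodule.span ℝ ((L : Set (Vd d)) ∩ (Λ : Set (Vd d))) = L) (s : Vd d) :
    ∃ m : Measure (Vd d), Good m (L : Set (Vd d)) ∧
      IsCanonicalMeasure Λ ((fun x => s + x) '' (L : Set (Vd d))) m ∧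
      ∀ c : Set (Vd d), Convex ℝ c → ∀ᵐ y ∂m, y - s ∈ L ∧
        (y - s ∈ c → ∀ u ∈ L, ∃ ε : ℝ, 0 < ε ∧ y - s + ε • u ∈ c) := by
  obtain ⟨k, v, hvΛ, hv, hspan, hint⟩ := lat_basis hΛ L hL
  set f : (Fin k → ℝ) →ₗ[ℝ] Vd d := Fintype.linearCombination ℝ v with hf
  have hfa : ∀ t, f t = ∑ i, t i • v i := fun t => Fintype.linearCombination_apply ℝ v t
  have hfinj : Function.Injective f := by
    rw [hf]; exact hv.fintypeLinearCombination_injective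
  have hker : LinearMap.ker f = ⊥ := LinearMap.ker_eq_bot.2 hfinj
  have hfL : ∀ x, x ∈ L ↔ ∃ t, f t = x := by
    intro x
    rw [← hspan, Submodule.mem_span_range_iff_exists_fun]
    simp only [hfa]
  set p : (Fin k → ℝ) → Vd d := fun t => s + ∑ i, t i • v i with hp
  have hpf : ∀ t, p t = s + f t := fun t => by rw [hfa]
  have hpe : MeasurableEmbedding p := by
    have h1 : MeasurableEmbedding f :=
      (LinearMap.isClosedEmbedding_of_injective hker).measurableEmbedding
    have h2 := (measurableEmbedding_addLeft s).comp h1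
    have : p = (fun x => s + x) ∘ f := by ext1 t; exact hpf t
    rw [this]; exact h2
  refine ⟨Measure.map p volume, ⟨?_, ?_⟩, ?_, ?_⟩
  · intro B hB
    rw [hpe.map_apply]
    obtain ⟨K, _, hK⟩ := f.exists_antilipschitzWith hker
    have h1 : p ⁻¹' B = f ⁻¹' ((fun x => -s + x) '' B) := by
      ext t
      simp only [Set.mem_preimage, Set.mem_image, hpf]
      constructor
      · intro h; exact ⟨_, h, by simp⟩
      · rintro ⟨y, hy, h⟩
        rw [← h]; simpa using hy
    rw [h1]
    have h2 : Bornology.IsBounded ((fun x => -s + x) '' B) := by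
      exact (IsometryEquiv.addLeft (-s)).isometry.lipschitz.isBounded_image hB
    exact (hK.isBounded_preimage h2).measure_lt_top
  · intro w hw
    obtain ⟨c, hc⟩ := (hfL w).1 hw
    refine ⟨(measurableEmbedding_sub w).measurable, ?_⟩
    rw [Measure.map_map (measurableEmbedding_sub w).measurable hpe.measurable]
    have h1 : (fun x => x - w) ∘ p = p ∘ (fun t => t - c) := by
      ext1 t
      simp only [Function.comp, hpf, map_sub, hc]; abel
    have hsub : MeasurePreserving (fun t : Fin k → ℝ => t - c) volume volume :=
      measurePreserving_sub_right volume c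
    rw [h1, ← Measure.map_map hpe.measurable hsub.measurable, hsub.map_eq]
  · refine ⟨k, s, v, ⟨0, L.zero_mem, by simp⟩, hvΛ, hv, ?_, ?_, rfl⟩
    · ext x
      constructor
      · rintro ⟨y, hy, rfl⟩
        obtain ⟨t, rfl⟩ := (hfL y).1 hy
        exact ⟨t, by rw [hfa]⟩
      · rintro ⟨t, rfl⟩
        exact ⟨f t, (hfL _).2 ⟨t, rfl⟩, by rw [hfa]⟩
    · intro y hy hy'
      exact hint y hy (by rw [← hspan]; exact hy')
  · intro c hc
    rw [hpe.ae_map_iff]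
    have h0 : volume (frontier (f ⁻¹' c)) = 0 := (hc.linear_preimage f).addHaar_frontier volume
    filter_upwards [measure_eq_zero_iff_ae_notMem.1 h0] with t ht
    have e : p t - s = f t := by rw [hpf]; abel
    rw [e]
    refine ⟨(hfL _).2 ⟨t, rfl⟩, fun hmem u hu => ?_⟩
    have hi : t ∈ interior (f ⁻¹' c) := by
      by_contra hi
      exact ht ⟨subset_closure hmem, hi⟩
    obtain ⟨w, rfl⟩ := (hfL u).1 hu
    have hcont : Tendsto (fun ε : ℝ => t + ε • w) (𝓝[>] 0) (𝓝 t) := by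
      have : Tendsto (fun ε : ℝ => t + ε • w) (𝓝 0) (𝓝 (t + (0:ℝ) • w)) :=
        (continuous_const.add (continuous_id.smul continuous_const)).tendsto 0
      rw [zero_smul, add_zero] at this
      exact this.mono_left nhdsWithin_le_nhds
    obtain ⟨ε, h1, h2⟩ := ((hcont.eventually (isOpen_interior.mem_nhds hi)).and
      self_mem_nhdsWithin).exists
    refine ⟨ε, h2, ?_⟩
    have := interior_subset h1
    simpa using this

theorem I_point {d : ℕ} {Λ : AddSubgroup (Vd d)} (hΛ : IsLatticeSub Λ)
    {I : Set (Vd d) → Vd d → ℝ} (hI : IsIMap Λ I) {s : Vd d} (hs : IsRatPoint Λ s) (ξ : Vd d) :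
    I {s} ξ = Real.exp (pairE ξ s) := by
  have hP : IsRatPolyhedron Λ {s} := by
    have := ratPoly_cone hΛ ∅ (by simp) hs
    convert this using 1
    have : cone (∅ : Finset (Vd d)) = {0} := by
      ext x; simp [cone]
    rw [this]; simp
  have hm : IsCanonicalMeasure Λ
      ((affineSpan ℝ ({s} : Set (Vd d)) : AffineSubspace ℝ (Vd d)) : Set (Vd d))
      (Measure.dirac s) := by
    refine ⟨0, s, Fin.elim0, by simp, fun i => i.elim0, linearIndependent_empty_type, ?_, ?_, ?_⟩
    · ext x; simp
    · intro y _ hy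
      refine ⟨Fin.elim0, ?_⟩
      simpa using hy
    · have : (volume : Measure (Fin 0 → ℝ)) = Measure.dirac 0 :=
        Measure.volume_pi_eq_dirac _
      rw [this, Measure.map_dirac' (by fun_prop)]
      simp
  have h1 := hI.2.2 {s} hP _ hm ξ ?_
  · rw [h1, Measure.restrict_singleton]
    simp
  · have hcont : Continuous fun x => Real.exp (pairE ξ x) :=
      Real.continuous_exp.comp (continuous_pairE ξ)
    rw [integrableOn_singleton_iff]
    simp

open MeasureTheory Filter Topology Set
open scoped RealInnerProductSpace Pointwise BigOperators ENNReal

/-! ### Orthogonal projections and quotient lattices -/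

theorem coproj_exists {d : ℕ} (Q : Vd d →ₗ[ℝ] Vd d →ₗ[ℝ] ℝ)
    (hpos : ∀ x : Vd d, x ≠ 0 → 0 < Q x x) (L : Submodule ℝ (Vd d)) :
    ∃ π, IsQCoproj Q L π := by
  set R : Vd d →ₗ[ℝ] (L →ₗ[ℝ] ℝ) := Q.compl₂ L.subtype with hR
  set B : L →ₗ[ℝ] (L →ₗ[ℝ] ℝ) := R ∘ₗ L.subtype with hB
  have hinj : Function.Injective B := by
    rw [← LinearMap.ker_eq_bot, LinearMap.ker_eq_bot']
    intro x hx
    by_contra h0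
    have h1 : B x x = 0 := by rw [hx]; rfl
    have h2 := hpos (x : Vd d) (by simpa using h0)
    exact h2.ne' h1
  let e := LinearEquiv.ofInjectiveOfFinrankEq B hinj (Subspace.dual_finrank_eq).symm
  let P : Vd d →ₗ[ℝ] Vd d := L.subtype ∘ₗ e.symm.toLinearMap ∘ₗ R
  refine ⟨LinearMap.id - P, fun x => ?_, fun x y hy => ?_⟩
  · have : x - (LinearMap.id - P : Vd d →ₗ[ℝ] Vd d) x = P x := by simp
    rw [this]
    exact (e.symm (R x)).2
  · have h1 : B (e.symm (R x)) = R x := e.apply_symm_apply (R x)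
    have h2 : B (e.symm (R x)) ⟨y, hy⟩ = R x ⟨y, hy⟩ := by rw [h1]
    have h3 : Q (P x) y = Q x y := h2
    simp [h3]

theorem coproj_ker {d : ℕ} {Q : Vd d →ₗ[ℝ] Vd d →ₗ[ℝ] ℝ}
    (hpos : ∀ x : Vd d, x ≠ 0 → 0 < Q x x) {L : Submodule ℝ (Vd d)} {π : Vd d →ₗ[ℝ] Vd d}
    (h : IsQCoproj Q L π) (x : Vd d) : π x = 0 ↔ x ∈ L := by
  constructor
  · intro h0
    have := h.1 x
    rwa [h0, sub_zero] at this
  · intro hx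
    by_contra h0
    have h1 : π x ∈ L := by
      have := L.sub_mem hx (h.1 x)
      simpa using this
    exact (hpos _ h0).ne' (h.2 x _ h1)

theorem coproj_bot {d : ℕ} {Q : Vd d →ₗ[ℝ] Vd d →ₗ[ℝ] ℝ} {π : Vd d →ₗ[ℝ] Vd d}
    (h : IsQCoproj Q ⊥ π) : π = LinearMap.id := by
  ext1 x
  have := h.1 x
  rw [Submodule.mem_bot, sub_eq_zero] at this
  exact this.symm

theorem quot_refl {d : ℕ} (Q : Vd d →ₗ[ℝ] Vd d →ₗ[ℝ] ℝ) (Λ : AddSubgroup (Vd d)) :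
    IsQuotLattice Q Λ Λ := by
  refine ⟨⊥, LinearMap.id, ?_, ⟨fun x => by simp, fun x y hy => ?_⟩, ?_⟩
  · rw [Submodule.span_eq_bot]
    rintro x ⟨hx, _⟩
    simpa using hx
  · rw [Submodule.mem_bot] at hy
    simp [hy]
  · ext x; simp

theorem quot_trans {d : ℕ} {Q : Vd d →ₗ[ℝ] Vd d →ₗ[ℝ] ℝ} {Λ Λ' : AddSubgroup (Vd d)}
    (h : IsQuotLattice Q Λ Λ') {L : Submodule ℝ (Vd d)}
    (hL : Submodule.span ℝ ((L : Set (Vd d)) ∩ (Λ' : Set (Vd d))) = L) {π : Vd d →ₗ[ℝ] Vd d}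
    (hπ : IsQCoproj Q L π) : IsQuotLattice Q Λ (AddSubgroup.map π.toAddMonoidHom Λ') := by
  obtain ⟨L0, π0, h0, hπ0, rfl⟩ := h
  have horth : ∀ x ∈ L, ∀ y ∈ L0, Q x y = 0 := by
    intro x hx y hy
    rw [← hL] at hx
    induction hx using Submodule.span_induction with
    | mem x hx =>
      obtain ⟨_, z, _, rfl⟩ := hx
      exact hπ0.2 z y hy
    | zero => simp
    | add x z _ _ h1 h2 => simp [h1, h2]
    | smul a x _ h1 => simp [h1]
  refine ⟨L0 ⊔ L, π ∘ₗ π0, ?_, ⟨fun x => ?_, fun x y hy => ?_⟩, ?_⟩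
  · apply le_antisymm
    · rw [Submodule.span_le]; exact Set.inter_subset_left
    · have h1 : L0 ≤ Submodule.span ℝ (((L0 ⊔ L : Submodule ℝ (Vd d)) : Set (Vd d)) ∩ Λ) := by
        conv_lhs => rw [← h0]
        apply Submodule.span_mono
        rintro x ⟨hx, hx'⟩
        exact ⟨Submodule.mem_sup_left hx, hx'⟩
      refine sup_le h1 ?_
      conv_lhs => rw [← hL]
      rw [Submodule.span_le]
      rintro y ⟨hy, x, hx, hxy⟩
      have hxy' : π0 x = y := hxy
      have h2 : x - y ∈ L0 := by rw [← hxy']; exact hπ0.1 x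
      have h3 : x ∈ Submodule.span ℝ (((L0 ⊔ L : Submodule ℝ (Vd d)) : Set (Vd d)) ∩ Λ) := by
        refine Submodule.subset_span ⟨?_, hx⟩
        have := Submodule.add_mem _ (Submodule.mem_sup_left h2 : x - y ∈ L0 ⊔ L)
          (Submodule.mem_sup_right hy)
        simpa using this
      have := Submodule.sub_mem _ h3 (h1 h2)
      simpa using this
  · have := Submodule.add_mem _ (Submodule.mem_sup_left (hπ0.1 x) : x - π0 x ∈ L0 ⊔ L)
      (Submodule.mem_sup_right (hπ.1 (π0 x)))
    simpa using this
  · obtain ⟨y0, hy0, y1, hy1, rfl⟩ := Submodule.mem_sup.1 hy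
    have a : Q (π (π0 x)) y0 = 0 := by
      have e : π (π0 x) = π0 x - (π0 x - π (π0 x)) := by abel
      rw [e, map_sub, LinearMap.sub_apply, hπ0.2 x y0 hy0, horth _ (hπ.1 (π0 x)) y0 hy0, sub_zero]
    have b : Q (π (π0 x)) y1 = 0 := hπ.2 _ y1 hy1
    simp [a, b]
  · rw [AddSubgroup.map_map]; rfl

theorem ratPoint_map {d : ℕ} {Λ : AddSubgroup (Vd d)} {s : Vd d} (hs : IsRatPoint Λ s)
    (π : Vd d →ₗ[ℝ] Vd d) : IsRatPoint (AddSubgroup.map π.toAddMonoidHom Λ) (π s) := by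
  obtain ⟨q, hq, h⟩ := hs
  exact ⟨q, hq, _, h, by simp⟩

/-! ### Faces of cones -/

open Classical in
/-- the generators lying in `L` -/
noncomputable def TL {d : ℕ} (T : Finset (Vd d)) (L : Submodule ℝ (Vd d)) : Finset (Vd d) :=
  T.filter (· ∈ L)

theorem mem_TL {d : ℕ} {T : Finset (Vd d)} {L : Submodule ℝ (Vd d)} {v : Vd d} :
    v ∈ TL T L ↔ v ∈ T ∧ v ∈ L := by simp [TL]

/-- `L` is the linear span of a face of `cone T` -/
def FaceSp {d : ℕ} (T : Finset (Vd d)) (L : Submodule ℝ (Vd d)) : Prop :=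
  ∃ ψ : Vd d, (∀ v ∈ T, pairE ψ v ≤ 0) ∧ L = Submodule.span ℝ {v | v ∈ T ∧ pairE ψ v = 0}

theorem pairE_zero_of_span {d : ℕ} {A : Set (Vd d)} {ψ : Vd d} (h : ∀ v ∈ A, pairE ψ v = 0)
    {x : Vd d} (hx : x ∈ Submodule.span ℝ A) : pairE ψ x = 0 := by
  induction hx using Submodule.span_induction with
  | mem x hx => exact h x hx
  | zero => exact pairE_zero_right _
  | add x z _ _ h1 h2 => rw [pairE_add_right, h1, h2, add_zero]
  | smul a x _ h1 => rw [pairE_smul_right, h1, mul_zero]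

theorem cone_pair_nonpos {d : ℕ} {T : Finset (Vd d)} {ψ : Vd d} (hψ : ∀ v ∈ T, pairE ψ v ≤ 0)
    {x : Vd d} (hx : x ∈ cone T) : pairE ψ x ≤ 0 := by
  obtain ⟨t, ht, rfl⟩ := hx
  rw [pairE_sum_right]
  refine Finset.sum_nonpos fun v hv => ?_
  rw [pairE_smul_right]
  exact mul_nonpos_of_nonneg_of_nonpos (ht v hv) (hψ v hv)

theorem cone_face {d : ℕ} {T T' : Finset (Vd d)} {ψ : Vd d} (hψ : ∀ v ∈ T, pairE ψ v ≤ 0)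
    (hT' : ∀ v, v ∈ T' ↔ v ∈ T ∧ pairE ψ v = 0) (x : Vd d) :
    (x ∈ cone T ∧ pairE ψ x = 0) ↔ x ∈ cone T' := by
  constructor
  · rintro ⟨⟨t, ht, rfl⟩, h0⟩
    rw [pairE_sum_right] at h0
    have h1 := (Finset.sum_eq_zero_iff_of_nonpos (fun v hv => by
      rw [pairE_smul_right]
      exact mul_nonpos_of_nonneg_of_nonpos (ht v hv) (hψ v hv))).1 h0
    refine cone_sum_mem _ _ fun v hv => ?_
    have h2 := h1 v hv
    rw [pairE_smul_right] at h2
    rcases mul_eq_zero.1 h2 with h3 | h3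
    · rw [h3, zero_smul]; exact cone_zero_mem _
    · exact cone_smul_mem (cone_gen_mem ((hT' v).2 ⟨hv, h3⟩)) (ht v hv)
  · intro hx
    refine ⟨cone_mono (fun v hv => ((hT' v).1 hv).1) hx, ?_⟩
    exact pairE_zero_of_span (fun v hv => ((hT' v).1 hv).2) (cone_subset_span _ hx)

theorem faceSp_TL {d : ℕ} {T : Finset (Vd d)} {L : Submodule ℝ (Vd d)} {ψ : Vd d}
    (h : L = Submodule.span ℝ {v | v ∈ T ∧ pairE ψ v = 0}) (v : Vd d) :
    v ∈ TL T L ↔ v ∈ T ∧ pairE ψ v = 0 := by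
  rw [mem_TL]
  constructor
  · rintro ⟨h1, h2⟩
    refine ⟨h1, ?_⟩
    rw [h] at h2
    exact pairE_zero_of_span (fun v hv => hv.2) h2
  · rintro ⟨h1, h2⟩
    refine ⟨h1, ?_⟩
    rw [h]; exact Submodule.subset_span ⟨h1, h2⟩

theorem faceSp_span {d : ℕ} {T : Finset (Vd d)} {L : Submodule ℝ (Vd d)} (h : FaceSp T L) :
    Submodule.span ℝ (TL T L : Set (Vd d)) = L := by
  obtain ⟨ψ, hψ, h⟩ := h
  have : (TL T L : Set (Vd d)) = {v | v ∈ T ∧ pairE ψ v = 0} := by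
    ext v; exact faceSp_TL h v
  rw [this, ← h]

theorem faceSp_line {d : ℕ} {T : Finset (Vd d)} {L : Submodule ℝ (Vd d)} (h : FaceSp T L)
    {u : Vd d} (h1 : u ∈ cone T) (h2 : -u ∈ cone T) : u ∈ cone (TL T L) ∧ -u ∈ cone (TL T L) := by
  obtain ⟨ψ, hψ, h⟩ := h
  have a := cone_pair_nonpos hψ h1
  have b := cone_pair_nonpos hψ h2
  have e : pairE ψ (-u) = - pairE ψ u := by
    rw [← neg_one_smul ℝ u, pairE_smul_right]; ring
  constructor
  · exact (cone_face hψ (faceSp_TL h) u).1 ⟨h1, by linarith⟩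
  · exact (cone_face hψ (faceSp_TL h) _).1 ⟨h2, by linarith⟩

theorem faceSp_inter {d : ℕ} {T : Finset (Vd d)} {L : Submodule ℝ (Vd d)} (h : FaceSp T L)
    {u : Vd d} : u ∈ cone (TL T L) ↔ u ∈ cone T ∧ u ∈ L := by
  have hs := faceSp_span h
  obtain ⟨ψ, hψ, h⟩ := h
  constructor
  · intro hu
    refine ⟨((cone_face hψ (faceSp_TL h) u).2 hu).1, ?_⟩
    rw [← hs]; exact cone_subset_span _ hu
  · rintro ⟨h1, h2⟩
    refine (cone_face hψ (faceSp_TL h) u).1 ⟨h1, ?_⟩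
    rw [h] at h2
    exact pairE_zero_of_span (fun v hv => hv.2) h2

theorem face_iff {d : ℕ} (T : Finset (Vd d)) (s : Vd d) (F : Set (Vd d)) :
    IsFaceOf ((fun x => s + x) '' cone T) F ↔
      ∃ L, FaceSp T L ∧ F = (fun x => s + x) '' cone (TL T L) := by
  have key : ∀ (φ : Vd d), (∀ v ∈ T, pairE φ v ≤ 0) →
      {x ∈ (fun x => s + x) '' cone T | ∀ y ∈ (fun x => s + x) '' cone T, pairE φ y ≤ pairE φ x}
      = (fun x => s + x) '' cone (TL T (Submodule.span ℝ {v | v ∈ T ∧ pairE φ v = 0})) := by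
    intro φ hφ
    ext x
    rw [mem_tr, ← cone_face hφ (faceSp_TL rfl)]
    constructor
    · rintro ⟨h1, h2⟩
      rw [mem_tr] at h1
      refine ⟨h1, le_antisymm (cone_pair_nonpos hφ h1) ?_⟩
      have := h2 s ⟨0, cone_zero_mem T, by simp⟩
      rw [pairE_sub_right]; linarith
    · rintro ⟨h1, h2⟩
      refine ⟨(mem_tr _ _ _).2 h1, ?_⟩
      rintro _ ⟨y, hy, rfl⟩
      have := cone_pair_nonpos hφ hy
      rw [pairE_sub_right] at h2
      simp only [pairE_add_right]; linarith
  constructor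
  · rintro ⟨⟨x, hx⟩, φ, rfl⟩
    have hφ : ∀ v ∈ T, pairE φ v ≤ 0 := by
      intro v hv
      obtain ⟨h1, h2⟩ := hx
      have h3 := h2 (x + v) (by
        rw [mem_tr] at h1 ⊢
        have := cone_add_mem h1 (cone_gen_mem hv)
        convert this using 1; abel)
      rw [pairE_add_right] at h3; linarith
    exact ⟨_, ⟨φ, hφ, rfl⟩, key φ hφ⟩
  · rintro ⟨L, ⟨φ, hφ, rfl⟩, rfl⟩
    exact ⟨⟨s, 0, cone_zero_mem _, by simp⟩, φ, (key φ hφ).symm⟩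

theorem span_cone {d : ℕ} (T : Finset (Vd d)) :
    Submodule.span ℝ (cone T) = Submodule.span ℝ (T : Set (Vd d)) := by
  apply le_antisymm
  · rw [Submodule.span_le]; exact cone_subset_span T
  · exact Submodule.span_mono fun v hv => cone_gen_mem hv

theorem dir_cone {d : ℕ} (T : Finset (Vd d)) (s : Vd d) :
    (affineSpan ℝ ((fun x => s + x) '' cone T)).direction = Submodule.span ℝ (T : Set (Vd d)) := by
  have hs : s ∈ (fun x => s + x) '' cone T := ⟨0, cone_zero_mem T, by simp⟩
  rw [direction_affineSpan, vectorSpan_eq_span_vsub_set_right ℝ hs, Set.image_image]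
  simp [span_cone]

theorem coe_aff_cone {d : ℕ} (T : Finset (Vd d)) (s : Vd d) :
    ((affineSpan ℝ ((fun x => s + x) '' cone T) : AffineSubspace ℝ (Vd d)) : Set (Vd d))
      = (fun x => s + x) '' (Submodule.span ℝ (T : Set (Vd d)) : Set (Vd d)) := by
  have hs : s ∈ affineSpan ℝ ((fun x => s + x) '' cone T) :=
    subset_affineSpan ℝ _ ⟨0, cone_zero_mem T, by simp⟩
  ext x
  rw [mem_tr, SetLike.mem_coe, ← AffineSubspace.vsub_right_mem_direction_iff_mem hs, dir_cone]
  rfl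

theorem cone_image {d : ℕ} [DecidableEq (Vd d)] (π : Vd d →ₗ[ℝ] Vd d) (T : Finset (Vd d)) :
    π '' cone T = cone ((T.image π).filter (· ≠ 0)) := by
  ext x
  constructor
  · rintro ⟨y, ⟨t, ht, rfl⟩, rfl⟩
    rw [map_sum]
    refine cone_sum_mem _ _ fun v hv => ?_
    rw [map_smul]
    by_cases h0 : π v = 0
    · rw [h0, smul_zero]; exact cone_zero_mem _
    · exact cone_smul_mem (cone_gen_mem (by simp [h0]; exact ⟨v, hv, rfl⟩)) (ht v hv)
  · rintro ⟨t, ht, rfl⟩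
    have : ∀ w ∈ (T.image π).filter (· ≠ 0), ∃ v ∈ T, π v = w := by
      intro w hw
      simpa using (Finset.mem_filter.1 hw).1
    choose! g hg hg' using this
    refine ⟨∑ w ∈ (T.image π).filter (· ≠ 0), t w • g w,
      cone_sum_mem _ _ fun w hw => cone_smul_mem (cone_gen_mem (hg w hw)) (ht w hw), ?_⟩
    rw [map_sum]
    refine Finset.sum_congr rfl fun w hw => ?_
    rw [map_smul, hg' w hw]

theorem supp_image {d : ℕ} {T : Finset (Vd d)} {L : Submodule ℝ (Vd d)} (h : FaceSp T L) (s : Vd d)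
    (π : Vd d →ₗ[ℝ] Vd d) (hπ : ∀ x ∈ L, π x = 0) :
    π '' suppCone ((fun x => s + x) '' cone T) ((fun x => s + x) '' cone (TL T L))
      = (fun x => π s + x) '' (π '' cone T) := by
  have hL := faceSp_span h
  ext z
  constructor
  · rintro ⟨_, ⟨a, ha, u, ⟨x, hx, ε, hε, hu⟩, rfl⟩, rfl⟩
    rw [coe_aff_cone, hL, mem_tr] at ha
    have hx' := intrinsicInterior_subset hx
    rw [mem_tr] at hx'
    have hxL : π (x - s) = 0 := hπ _ (by rw [← hL]; exact cone_subset_span _ hx')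
    have h1 := hu ε hε le_rfl
    rw [mem_tr] at h1
    rw [mem_tr]
    refine ⟨ε⁻¹ • (x + ε • u - s), cone_smul_mem h1 (inv_nonneg.2 hε.le), ?_⟩
    have h2 : π (a - s) = 0 := hπ _ ha
    rw [map_sub] at hxL h2
    rw [map_smul, map_sub, map_add, map_add, map_smul, sub_eq_zero.1 hxL, sub_eq_zero.1 h2,
      add_sub_cancel_left, add_sub_cancel_left, smul_smul, inv_mul_cancel₀ hε.ne', one_smul]
  · rintro ⟨_, ⟨c, hc, rfl⟩, rfl⟩
    have hconv : Convex ℝ ((fun x => s + x) '' cone (TL T L)) := by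
      simpa using (cone_convex (TL T L)).translate s
    have hne : ((fun x => s + x) '' cone (TL T L)).Nonempty := ⟨_, 0, cone_zero_mem _, rfl⟩
    obtain ⟨x, hx⟩ := hne.intrinsicInterior hconv
    refine ⟨s + c, ⟨s, ?_, c, ⟨x, hx, 1, one_pos, fun t ht _ => ?_⟩, rfl⟩, by simp⟩
    · exact subset_affineSpan ℝ _ ⟨0, cone_zero_mem _, by simp⟩
    · have hx' := intrinsicInterior_subset hx
      rw [mem_tr] at hx' ⊢
      have h1 : x - s ∈ cone T := ((faceSp_inter h).1 hx').1
      have := cone_add_mem h1 (cone_smul_mem hc ht.le)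
      convert this using 1; abel

theorem faceSp_bot {d : ℕ} (T : Finset (Vd d)) (hT : ∀ v ∈ T, v ≠ 0) (s : Vd d)
    (h : ¬ ContainsLine ((fun x => s + x) '' cone T)) : FaceSp T ⊥ := by
  rcases gordan T with ⟨v, hv, hv'⟩ | ⟨ψ, hψ⟩
  · exact absurd (containsLine_of T s (hT v hv) (cone_gen_mem hv) hv') h
  · refine ⟨ψ, fun v hv => (hψ v hv).le, ?_⟩
    symm
    rw [Submodule.span_eq_bot]
    rintro v ⟨h1, h2⟩
    exact absurd h2 (hψ v h1).ne

theorem faceSp_of_pointed {d : ℕ} (T : Finset (Vd d)) (L : Submodule ℝ (Vd d))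
    (π : Vd d →ₗ[ℝ] Vd d) (hπ : ∀ x, π x = 0 ↔ x ∈ L) (s y : Vd d)
    (h : ¬ ContainsLine ((fun x => s + x) '' (π '' cone T)))
    (hy : y ∈ cone T) (hyL : y ∈ L) (hgen : ∀ u ∈ L, ∃ ε : ℝ, 0 < ε ∧ y + ε • u ∈ cone T) :
    FaceSp T L := by
  classical
  rw [cone_image] at h
  rcases gordan ((T.image π).filter (· ≠ 0)) with ⟨v, hv, hv'⟩ | ⟨ξ, hξ⟩
  · exact absurd (containsLine_of _ s (Finset.mem_filter.1 hv).2 (cone_gen_mem hv) hv') h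
  · obtain ⟨ξ', hξ'⟩ := exists_rep (innerₛₗ ℝ ξ)
    obtain ⟨ψ, hψ⟩ := exists_rep ((innerₛₗ ℝ ξ) ∘ₗ π)
    have hψ' : ∀ x, pairE ψ x = pairE ξ (π x) := fun x => hψ x
    have hneg : ∀ v ∈ T, v ∉ L → pairE ψ v < 0 := by
      intro v hv hvL
      rw [hψ']
      apply hξ
      rw [Finset.mem_filter]
      exact ⟨Finset.mem_image_of_mem _ hv, fun h0 => hvL ((hπ v).1 h0)⟩
    have hzero : ∀ v ∈ L, pairE ψ v = 0 := by
      intro v hv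
      rw [hψ', (hπ v).2 hv, pairE_zero_right]
    have hle : ∀ v ∈ T, pairE ψ v ≤ 0 := by
      intro v hv
      by_cases hvL : v ∈ L
      · exact (hzero v hvL).le
      · exact (hneg v hv hvL).le
    refine ⟨ψ, hle, ?_⟩
    have hset : {v | v ∈ T ∧ pairE ψ v = 0} = (TL T L : Set (Vd d)) := by
      ext v
      rw [Finset.mem_coe, mem_TL]
      constructor
      · rintro ⟨h1, h2⟩
        refine ⟨h1, ?_⟩
        by_contra h3
        exact (hneg v h1 h3).ne h2
      · rintro ⟨h1, h2⟩; exact ⟨h1, hzero v h2⟩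
    have hTL : ∀ v, v ∈ TL T L ↔ v ∈ T ∧ pairE ψ v = 0 := by
      intro v
      have : v ∈ {v | v ∈ T ∧ pairE ψ v = 0} ↔ v ∈ (TL T L : Set (Vd d)) := by rw [hset]
      exact this.symm
    have hc : ∀ x ∈ cone T, x ∈ L → x ∈ Submodule.span ℝ {v | v ∈ T ∧ pairE ψ v = 0} := by
      intro x hx hxL
      rw [hset]
      exact cone_subset_span _ ((cone_face hle hTL x).1 ⟨hx, hzero x hxL⟩)
    apply le_antisymm
    · intro u hu
      obtain ⟨ε, hε, h1⟩ := hgen u hu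
      have h2 := hc _ h1 (L.add_mem hyL (L.smul_mem _ hu))
      have h3 := Submodule.smul_mem _ ε⁻¹ (Submodule.sub_mem _ h2 (hc y hy hyL))
      rwa [add_sub_cancel_left, smul_smul, inv_mul_cancel₀ hε.ne', one_smul] at h3
    · rw [hset, Submodule.span_le]
      intro v hv
      exact (mem_TL.1 hv).2

open MeasureTheory Filter Topology Set
open scoped RealInnerProductSpace Pointwise BigOperators ENNReal

theorem S_val {d : ℕ} {Λ : AddSubgroup (Vd d)} (hΛ : IsLatticeSub Λ) {S : Set (Vd d) → Vd d → ℝ}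
    (hS : IsSMap Λ S) {s : Vd d} (hs : IsRatPoint Λ s) {n : ℕ} (T : Fin n → Finset (Vd d))
    (hT : ∀ i, ∀ w ∈ T i, w ≠ 0 ∧ w ∈ Λ) (r : Fin n → ℝ)
    (hrel : ∀ x : Vd d, ∑ i, Set.indicator (cone (T i)) (fun _ => r i) x = 0) :
    Gen fun ξ => ∑ i, r i * S ((fun x => s + x) '' cone (T i)) ξ = 0 := by
  have hP : ∀ i, IsRatPolyhedron Λ ((fun x => s + x) '' cone (T i)) := fun i =>
    ratPoly_cone hΛ (T i) (fun v hv => (hT i v hv).2) hs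
  have key := Gen.all (fun i => mero_key hΛ (cnt_good hΛ) (T i) (fun v hv => (hT i v hv).2) (hT i) s
    (S ((fun x => s + x) '' cone (T i))) (hS.1 _ (hP i)) (hS.2.1 _ (hP i)) (by
      intro ξ h
      obtain ⟨h1, h2⟩ := cnt_sum hΛ _ (tr_measurable hΛ (T i) (fun v hv => (hT i v hv).2) s) _ h
      rw [h2]
      exact hS.2.2 _ (hP i) ξ h1))
  refine key.mono fun ξ hξ => ?_
  refine val_zero (cnt_good hΛ) Finset.univ (fun i => (T i).toList)
    (fun i _ v hv => (hT i v (by simpa using hv)).2) (fun i => chi s (T i)) ξ _ r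
    (fun i _ => (hξ i).1) (fun i _ => (hξ i).2.1) (fun i _ => (hξ i).2.2) ?_
  refine Filter.Eventually.of_forall fun x => ?_
  refine Eq.trans ?_ (hrel (x - s))
  refine Finset.sum_congr rfl fun i _ => ?_
  unfold chi
  by_cases h : x - s ∈ cone (T i)
  · rw [Set.indicator_of_mem ((mem_tr s _ x).2 h), Set.indicator_of_mem h, mul_one]
  · rw [Set.indicator_of_notMem (fun h' => h ((mem_tr s _ x).1 h')), Set.indicator_of_notMem h,
      mul_zero]

theorem local_rel {d n : ℕ} (T : Fin n → Finset (Vd d)) (hcl : ∀ i, IsClosed (cone (T i)))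
    (r : Fin n → ℝ)
    (hrel : ∀ x : Vd d, ∑ i, Set.indicator (cone (T i)) (fun _ => r i) x = 0)
    (L : Submodule ℝ (Vd d)) (π : Vd d →ₗ[ℝ] Vd d) (hπ : ∀ x, π x = 0 ↔ x ∈ L)
    (y : Vd d) (hyL : y ∈ L)
    (hgen : ∀ i, y ∈ cone (T i) → ∀ u ∈ L, ∃ ε : ℝ, 0 < ε ∧ y + ε • u ∈ cone (T i))
    (A : Finset (Fin n)) (hA : ∀ i, i ∈ A ↔ y ∈ cone (T i)) (x : Vd d) :
    ∑ i, Set.indicator (π '' cone (T i)) (fun _ => if i ∈ A then r i else 0) x = 0 := by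
  by_cases hx : ∃ u, π u = x
  swap
  · refine Finset.sum_eq_zero fun i _ => ?_
    refine Set.indicator_of_notMem ?_ _
    rintro ⟨w, _, hw⟩
    exact hx ⟨w, hw⟩
  obtain ⟨u, rfl⟩ := hx
  have hev : ∀ᶠ t in 𝓝[>] (0 : ℝ), ∀ i,
      (y + t • u ∈ cone (T i) ↔ (i ∈ A ∧ π u ∈ π '' cone (T i))) := by
    refine Filter.eventually_all.2 fun i => ?_
    by_cases hy : y ∈ cone (T i)
    · by_cases hu : π u ∈ π '' cone (T i)
      · obtain ⟨w, hw, hwu⟩ := hu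
        have hl : u - w ∈ L := by rw [← hπ, map_sub, hwu, sub_self]
        obtain ⟨ε, hε, hε2⟩ := hgen i hy _ hl
        filter_upwards [Ioc_mem_nhdsGT hε] with t ht
        refine ⟨fun _ => ⟨(hA i).2 hy, w, hw, hwu⟩, fun _ => ?_⟩
        have e : y + t • u = ((1 - t / ε) • y + (t / ε) • (y + ε • (u - w))) + t • w := by
          have : t / ε * ε = t := by field_simp
          rw [smul_add, smul_smul, this]
          module
        rw [e]
        refine cone_add_mem (cone_add_mem (cone_smul_mem hy ?_) (cone_smul_mem hε2 ?_))
          (cone_smul_mem hw ht.1.le)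
        · rw [sub_nonneg, div_le_one hε]; exact ht.2
        · exact div_nonneg ht.1.le hε.le
      · filter_upwards [self_mem_nhdsWithin] with t ht
        have ht : 0 < t := ht
        refine ⟨fun h => absurd ?_ hu, fun h => absurd h.2 hu⟩
        refine ⟨t⁻¹ • (y + t • u), cone_smul_mem h (inv_nonneg.2 ht.le), ?_⟩
        rw [map_smul, map_add, (hπ y).2 hyL, zero_add, map_smul, smul_smul, inv_mul_cancel₀ ht.ne',
          one_smul]
    · have hc : Tendsto (fun t : ℝ => y + t • u) (𝓝[>] 0) (𝓝 y) := by
        have : Continuous (fun t : ℝ => y + t • u) := by fun_prop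
        have h2 := this.tendsto 0
        simp only [zero_smul, add_zero] at h2
        exact h2.mono_left nhdsWithin_le_nhds
      filter_upwards [hc.eventually ((hcl i).isOpen_compl.mem_nhds hy)] with t ht
      refine ⟨fun h => absurd h ht, fun h => absurd ((hA i).1 h.1) hy⟩
  obtain ⟨t, ht⟩ := hev.exists
  refine Eq.trans ?_ (hrel (y + t • u))
  refine Finset.sum_congr rfl fun i _ => ?_
  have := ht i
  classical
  simp only [Set.indicator_apply, this]
  by_cases h1 : i ∈ A <;> simp [h1]

open Classical in
theorem L_term {d : ℕ} {Λ : AddSubgroup (Vd d)} (hΛ : IsLatticeSub Λ) {I : Set (Vd d) → Vd d → ℝ}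
    (hI : IsIMap Λ I) {s : Vd d} (hs : IsRatPoint Λ s) {n : ℕ} (T : Fin n → Finset (Vd d))
    (hT : ∀ i, ∀ w ∈ T i, w ≠ 0 ∧ w ∈ Λ) (r : Fin n → ℝ)
    (hrel : ∀ x : Vd d, ∑ i, Set.indicator (cone (T i)) (fun _ => r i) x = 0)
    (L : Submodule ℝ (Vd d))
    (hL : Submodule.span ℝ ((L : Set (Vd d)) ∩ (Λ : Set (Vd d))) = L) (π : Vd d →ₗ[ℝ] Vd d)
    (hπ : ∀ x, π x = 0 ↔ x ∈ L) (f : Fin n → Vd d → ℝ)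
    (hline : ∀ i, ContainsLine ((fun x => π s + x) '' (π '' cone (T i))) → ∀ ξ, f i ξ = 0)
    (hIH : ∀ r' : Fin n → ℝ,
      (∀ x : Vd d, ∑ i, Set.indicator (π '' cone (T i)) (fun _ => r' i) x = 0) →
      Gen fun ξ => ∑ i, r' i * f i ξ = 0) :
    Gen fun ξ => ∑ i, r i * (if FaceSp (T i) L then
      f i ξ * I ((fun x => s + x) '' cone (TL (T i) L)) ξ else 0) = 0 := by
  obtain ⟨m, hm, hcan, hgenm⟩ := canon hΛ L hL s
  have hTL : ∀ i, ∀ w ∈ TL (T i) L, w ≠ 0 ∧ w ∈ Λ := fun i w hw => hT i w (mem_TL.1 hw).1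
  have hP : ∀ i, IsRatPolyhedron Λ ((fun x => s + x) '' cone (TL (T i) L)) := fun i =>
    ratPoly_cone hΛ _ (fun v hv => (hTL i v hv).2) hs
  have key : Gen fun ξ => ∀ i, FaceSp (T i) L →
      Integrable (fun x => DD (TL (T i) L).toList (chi s (TL (T i) L)) x * Real.exp (pairE ξ x)) m ∧
      I ((fun x => s + x) '' cone (TL (T i) L)) ξ * ev (TL (T i) L).toList ξ
        = ∫ x, DD (TL (T i) L).toList (chi s (TL (T i) L)) x * Real.exp (pairE ξ x) ∂m ∧
      ev (TL (T i) L).toList ξ ≠ 0 := by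
    refine Gen.all fun i => ?_
    by_cases hF : FaceSp (T i) L
    swap
    · exact Gen.of_forall fun ξ h => absurd h hF
    refine (mero_key hΛ hm (TL (T i) L) (fun v hv => (mem_TL.1 hv).2) (hTL i) s
      (I ((fun x => s + x) '' cone (TL (T i) L))) (hI.1 _ (hP i)) (hI.2.1 _ (hP i)) ?_).mono
        fun ξ h _ => h
    intro ξ h
    refine hI.2.2 _ (hP i) m ?_ ξ h
    rw [coe_aff_cone, faceSp_span hF]
    exact hcan
  let good : Vd d → Prop := fun y => y ∈ L ∧ ∀ i, y ∈ cone (T i) →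
    ∀ u ∈ L, ∃ ε : ℝ, 0 < ε ∧ y + ε • u ∈ cone (T i)
  have hA : Gen fun ξ => ∀ A : Finset (Fin n), (∃ y, good y ∧ ∀ i, i ∈ A ↔ y ∈ cone (T i)) →
      ∑ i, (if i ∈ A then r i else 0) * f i ξ = 0 := by
    refine Gen.all fun A => ?_
    by_cases hy : ∃ y, good y ∧ ∀ i, i ∈ A ↔ y ∈ cone (T i)
    swap
    · exact Gen.of_forall fun ξ h => absurd h hy
    obtain ⟨y, hg, hyA⟩ := hy
    refine (hIH (fun i => if i ∈ A then r i else 0) ?_).mono fun ξ h _ => h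
    exact local_rel T (fun i => cone_isClosed hΛ (T i) fun v hv => (hT i v hv).2) r hrel L π hπ y
      hg.1 hg.2 A hyA
  have hae : ∀ᵐ x ∂m, good (x - s) := by
    have h1 : ∀ᵐ x ∂m, ∀ i, x - s ∈ L ∧ (x - s ∈ cone (T i) →
        ∀ u ∈ L, ∃ ε : ℝ, 0 < ε ∧ x - s + ε • u ∈ cone (T i)) :=
      ae_all_iff.2 fun i => hgenm _ (cone_convex (T i))
    have h2 := hgenm ∅ convex_empty
    filter_upwards [h1, h2] with x hx hx2
    exact ⟨hx2.1, fun i => (hx i).2⟩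
  refine (key.and hA).mono fun ξ ⟨h1, h2⟩ => ?_
  have h3 := val_zero hm (Finset.univ.filter fun i => FaceSp (T i) L)
    (fun i => (TL (T i) L).toList) (fun i _ v hv => (mem_TL.1 (by simpa using hv)).2)
    (fun i => chi s (TL (T i) L)) ξ (fun i => I ((fun x => s + x) '' cone (TL (T i) L)) ξ)
    (fun i => r i * f i ξ)
    (fun i hi => (h1 i (Finset.mem_filter.1 hi).2).1)
    (fun i hi => (h1 i (Finset.mem_filter.1 hi).2).2.1)
    (fun i hi => (h1 i (Finset.mem_filter.1 hi).2).2.2) ?_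
  · rw [Finset.sum_filter] at h3
    refine Eq.trans ?_ h3
    refine Finset.sum_congr rfl fun i _ => ?_
    split_ifs
    · ring
    · ring
  · filter_upwards [hae] with x hx
    have h4 := h2 (Finset.univ.filter fun i => x - s ∈ cone (T i)) ⟨x - s, hx, by simp⟩
    rw [Finset.sum_filter]
    refine Eq.trans ?_ h4
    refine Finset.sum_congr rfl fun i _ => ?_
    simp only [Finset.mem_filter, Finset.mem_univ, true_and]
    by_cases hc : x - s ∈ cone (T i)
    · rw [if_pos hc]
      by_cases hF : FaceSp (T i) L
      · have : x ∈ (fun x => s + x) '' cone (TL (T i) L) :=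
          (mem_tr _ _ _).2 ((faceSp_inter hF).2 ⟨hc, hx.1⟩)
        rw [if_pos hF]
        unfold chi
        rw [Set.indicator_of_mem this, mul_one]
      · rw [if_neg hF]
        have : ContainsLine ((fun x => π s + x) '' (π '' cone (T i))) := by
          by_contra hno
          exact hF (faceSp_of_pointed (T i) L π hπ (π s) (x - s) hno hc hx.1 (hx.2 i hc))
        rw [hline i this, mul_zero]
    · rw [if_neg hc, zero_mul]
      split_ifs with hF
      · have : x ∉ (fun x => s + x) '' cone (TL (T i) L) := fun h =>
          hc ((faceSp_inter hF).1 ((mem_tr _ _ _).1 h)).1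
        unfold chi
        rw [Set.indicator_of_notMem this, mul_zero]
      · rfl

open Classical in
theorem S_expand {d : ℕ} {Λ Λ' : AddSubgroup (Vd d)} (hΛ' : IsLatticeSub Λ')
    {Q : Vd d →ₗ[ℝ] Vd d →ₗ[ℝ] ℝ} {I S μ : AddSubgroup (Vd d) → Set (Vd d) → Vd d → ℝ}
    (hq : IsQuotLattice Q Λ Λ') (hI : IsIFamily Q Λ I) (hS : IsSFamily Q Λ S)
    (hμ : IsMuFamily Λ Q I S μ) {s : Vd d} (hs : IsRatPoint Λ' s) (T : Finset (Vd d))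
    (hT : ∀ w ∈ T, w ≠ 0 ∧ w ∈ Λ')
    (p : Submodule ℝ (Vd d) → Vd d →ₗ[ℝ] Vd d) (hp : ∀ L, IsQCoproj Q L (p L))
    (hker : ∀ L x, p L x = 0 ↔ x ∈ L)
    (C : Finset (Submodule ℝ (Vd d))) (hC : ∀ L, FaceSp T L → L ∈ C) :
    Gen fun ξ => S Λ' ((fun x => s + x) '' cone T) ξ = ∑ L ∈ C, if FaceSp T L then
      μ (AddSubgroup.map (p L).toAddMonoidHom Λ') ((fun x => p L s + x) '' (p L '' cone T)) ξ
        * I Λ' ((fun x => s + x) '' cone (TL T L)) ξ else 0 := by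
  have hT2 : ∀ w ∈ T, w ∈ Λ' := fun w hw => (hT w hw).2
  by_cases hl : ContainsLine ((fun x => s + x) '' cone T)
  · refine Gen.of_forall fun ξ => ?_
    rw [(hS Λ' hq).2.1 _ (ratPoly_cone hΛ' T hT2 hs) hl ξ]
    symm
    refine Finset.sum_eq_zero fun L _ => ?_
    split_ifs with hF
    · obtain ⟨u, hu, h1, h2⟩ := containsLine_cone hΛ' T hT2 s hl
      obtain ⟨h3, h4⟩ := faceSp_line hF h1 h2
      rw [(hI Λ' hq).2.1 _ (ratPoly_cone hΛ' _ (fun w hw => hT2 w (mem_TL.1 hw).1) hs)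
        (containsLine_of _ s hu h3 h4) ξ, mul_zero]
    · rfl
  · have h := hμ.1.2.2 Λ' hq _ (ratAffine_of_ratCone hs (ratCone_cone hT2)) hl
      (fun F => p (affineSpan ℝ F).direction) (fun F _ => hp _)
    refine Gen.mono h fun ξ hξ => ?_
    rw [hξ]
    have hset : {F | IsFaceOf ((fun x => s + x) '' cone T) F} =
        (fun L => (fun x => s + x) '' cone (TL T L)) '' {L | FaceSp T L} := by
      ext F
      simp only [Set.mem_image]
      refine (face_iff T s F).trans ?_
      constructor
      · rintro ⟨L, h1, h2⟩; exact ⟨L, h1, h2.symm⟩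
      · rintro ⟨L, h1, h2⟩; exact ⟨L, h1, h2.symm⟩
    have hdir : ∀ L, FaceSp T L →
        (affineSpan ℝ ((fun x => s + x) '' cone (TL T L))).direction = L := fun L hL => by
      rw [dir_cone, faceSp_span hL]
    have hinj : Set.InjOn (fun L => (fun x => s + x) '' cone (TL T L)) {L | FaceSp T L} := by
      intro L hL L' hL' e
      have e : (fun x => s + x) '' cone (TL T L) = (fun x => s + x) '' cone (TL T L') := e
      rw [← hdir L hL, ← hdir L' hL', e]
    beta_reduce
    rw [hset, finsum_mem_image hinj]
    have hset2 : {L | FaceSp T L} = ((C.filter fun L => FaceSp T L : Finset _) : Set _) := by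
      ext L
      simp only [Finset.coe_filter]
      exact ⟨fun h => ⟨hC L h, h⟩, fun h => h.2⟩
    rw [hset2, finsum_mem_coe_finset, Finset.sum_filter]
    refine Finset.sum_congr rfl fun L _ => ?_
    split_ifs with hF
    · rw [hdir L hF, supp_image hF s (p L) fun x hx => (hker L x).2 hx]
    · rfl

open MeasureTheory Filter Topology Set
open scoped RealInnerProductSpace Pointwise BigOperators ENNReal

open Classical in
theorem main_ind {d : ℕ} {Λ : AddSubgroup (Vd d)} {Q : Vd d →ₗ[ℝ] Vd d →ₗ[ℝ] ℝ}
    (hpos : ∀ x : Vd d, x ≠ 0 → 0 < Q x x)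
    {I S μ : AddSubgroup (Vd d) → Set (Vd d) → Vd d → ℝ}
    (hI : IsIFamily Q Λ I) (hS : IsSFamily Q Λ S) (hμ : IsMuFamily Λ Q I S μ) (N : ℕ) :
    ∀ Λ' : AddSubgroup (Vd d), IsLatticeSub Λ' → IsQuotLattice Q Λ Λ' →
      Module.finrank ℝ (Submodule.span ℝ (Λ' : Set (Vd d))) = N →
      ∀ s, IsRatPoint Λ' s → ∀ (n : ℕ) (c : Fin n → Set (Vd d)), (∀ i, IsRatCone Λ' (c i)) →
      ∀ r : Fin n → ℝ, (∀ x : Vd d, ∑ i, Set.indicator (c i) (fun _ => r i) x = 0) →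
      Gen fun ξ => ∑ i, r i * μ Λ' ((fun x => s + x) '' c i) ξ = 0 := by
  induction N using Nat.strong_induction_on with
  | _ N ih =>
  intro Λ' hΛ' hq hN s hs n c hc r hrel
  choose T hT hcT using fun i => ratCone_iff Λ' (c i) (hc i)
  obtain rfl : c = fun i => cone (T i) := funext hcT
  choose p hp using fun L => coproj_exists Q hpos L
  have hker : ∀ L x, p L x = 0 ↔ x ∈ L := fun L x => coproj_ker hpos (hp L) x
  set U : Finset (Vd d) := Finset.univ.biUnion T with hU
  have hUΛ : ∀ w ∈ U, w ∈ Λ' := by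
    intro w hw
    obtain ⟨i, _, hi⟩ := Finset.mem_biUnion.1 hw
    exact (hT i w hi).2
  set C : Finset (Submodule ℝ (Vd d)) :=
    U.powerset.image (fun W : Finset (Vd d) => Submodule.span ℝ (W : Set (Vd d))) with hC
  have hCface : ∀ i L, FaceSp (T i) L → L ∈ C := by
    intro i L hL
    refine Finset.mem_image.2 ⟨TL (T i) L, Finset.mem_powerset.2 fun v hv => ?_, faceSp_span hL⟩
    exact Finset.mem_biUnion.2 ⟨i, Finset.mem_univ _, (mem_TL.1 hv).1⟩
  have hCbot : (⊥ : Submodule ℝ (Vd d)) ∈ C :=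
    Finset.mem_image.2 ⟨∅, by simp, by simp⟩
  have hCrat : ∀ L ∈ C, Submodule.span ℝ ((L : Set (Vd d)) ∩ (Λ' : Set (Vd d))) = L := by
    intro L hL
    obtain ⟨W, hW, rfl⟩ := Finset.mem_image.1 hL
    refine le_antisymm (Submodule.span_le.2 Set.inter_subset_left) (Submodule.span_mono ?_)
    exact fun w hw => ⟨Submodule.subset_span hw, hUΛ w (Finset.mem_powerset.1 hW hw)⟩
  have h1 := S_val hΛ' (hS Λ' hq) hs T hT r hrel
  have h2 := Gen.all fun i => S_expand hΛ' hq hI hS hμ hs (T i) (hT i) p hp hker C (hCface i)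
  have h3 : Gen fun ξ => ∀ L ∈ C.erase ⊥, ∑ i, r i * (if FaceSp (T i) L then
      μ (AddSubgroup.map (p L).toAddMonoidHom Λ') ((fun x => p L s + x) '' (p L '' cone (T i))) ξ
        * I Λ' ((fun x => s + x) '' cone (TL (T i) L)) ξ else 0) = 0 := by
    refine Gen.finset _ fun L hL => ?_
    obtain ⟨hL0, hLC⟩ := Finset.mem_erase.1 hL
    have hrat := hCrat L hLC
    obtain ⟨hlat, hfin⟩ := lat_map hΛ' L hrat (p L) (hker L)
    have hq' := quot_trans hq hrat (hp L)
    have hs' := ratPoint_map hs (p L)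
    have hc' : ∀ i, IsRatCone (AddSubgroup.map (p L).toAddMonoidHom Λ') (p L '' cone (T i)) := by
      intro i
      rw [cone_image]
      refine ratCone_cone fun w hw => ?_
      obtain ⟨v, hv, rfl⟩ := Finset.mem_image.1 (Finset.mem_filter.1 hw).1
      exact ⟨v, (hT i v hv).2, rfl⟩
    have hlt : 0 < Module.finrank ℝ L := by
      rw [Module.finrank_pos_iff, Submodule.nontrivial_iff_ne_bot]
      exact hL0
    refine L_term hΛ' (hI Λ' hq) hs T hT r hrel L hrat (p L) (hker L)
      (fun i ξ => μ (AddSubgroup.map (p L).toAddMonoidHom Λ')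
        ((fun x => p L s + x) '' (p L '' cone (T i))) ξ) ?_ ?_
    · intro i hl ξ
      exact hμ.2 _ hq' _ (ratAffine_of_ratCone hs' (hc' i)) hl ξ
    · intro r' hr'
      exact ih _ (by omega) _ hlat hq' rfl _ hs' n _ hc' r' hr'
  refine ((h1.and h2).and h3).mono ?_
  rintro ξ ⟨⟨e1, e2⟩, e3⟩
  simp only [e2, Finset.mul_sum] at e1
  rw [Finset.sum_comm, ← Finset.add_sum_erase C _ hCbot, Finset.sum_eq_zero e3, add_zero] at e1
  have hpbot : p ⊥ = LinearMap.id := coproj_bot (hp ⊥)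
  have hmap : AddSubgroup.map (p ⊥).toAddMonoidHom Λ' = Λ' := by
    rw [hpbot]
    exact AddSubgroup.map_id Λ'
  have hTb : ∀ i, TL (T i) ⊥ = ∅ := by
    intro i
    refine Finset.eq_empty_of_forall_notMem fun v hv => ?_
    have := mem_TL.1 hv
    exact (hT i v this.1).1 (by simpa using this.2)
  have hface : ∀ i, I Λ' ((fun x => s + x) '' cone (TL (T i) ⊥)) ξ = Real.exp (pairE ξ s) := by
    intro i
    have : cone (∅ : Finset (Vd d)) = {0} := by
      ext x; simp [cone]
    rw [hTb, this, Set.image_singleton, add_zero]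
    exact I_point hΛ' (hI Λ' hq) hs ξ
  have e4 : (∑ i, r i * μ Λ' ((fun x => s + x) '' cone (T i)) ξ) * Real.exp (pairE ξ s) = 0 := by
    rw [Finset.sum_mul]
    refine Eq.trans ?_ e1
    refine Finset.sum_congr rfl fun i _ => ?_
    rw [hface i, hmap, hpbot]
    simp only [LinearMap.id_coe, Set.image_id', id_eq]
    split_ifs with hF
    · ring
    · have hl : ContainsLine ((fun x => s + x) '' cone (T i)) := by
        by_contra hno
        exact hF (faceSp_bot (T i) (fun v hv => (hT i v hv).1) s hno)
      rw [hμ.2 Λ' hq _ (ratAffine_of_ratCone hs (hc i)) hl ξ]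
      ring
  exact (mul_eq_zero.1 e4).resolve_right (Real.exp_ne_zero _)

/-- for a fixed rational point `s`, the map `c ↦ μ(s + c)` is a valuation on
rational convex cones: any linear relation `∑ rᵢ χ(cᵢ) = 0` among characteristic functions
yields `∑ rᵢ μ(s + cᵢ) = 0`. -/
theorem statement9 (d : ℕ) (Λ : AddSubgroup (Vd d)) (hΛ : IsFullLattice Λ)
    (Q : Vd d →ₗ[ℝ] Vd d →ₗ[ℝ] ℝ) (hQ : IsRatInner Λ Q)
    (I S μ : AddSubgroup (Vd d) → Set (Vd d) → Vd d → ℝ)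
    (hI : IsIFamily Q Λ I) (hS : IsSFamily Q Λ S) (hμ : IsMuFamily Λ Q I S μ)
    (s : Vd d) (hs : IsRatPoint Λ s)
    (n : ℕ) (c : Fin n → Set (Vd d)) (hc : ∀ i, IsRatCone Λ (c i))
    (r : Fin n → ℝ)
    (hrel : ∀ x : Vd d, ∑ i, Set.indicator (c i) (fun _ => r i) x = 0) :
    MeroEqAt0 (fun ξ => ∑ i, r i * μ Λ ((fun x => s + x) '' c i) ξ) (fun _ => 0) := by
  exact main_ind hQ.2.1 hI hS hμ _ Λ hΛ.1 (quot_refl Q Λ) rfl s hs n c hc r hrel
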